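/- arXiv:1303.2306 — 4 statements merged into one kernel-verified Lean document; each statement's English description precedes it below -/
import Mathlib

section
/- Let η₁, η₂, … be i.i.d. random variables with common distribution G having negative mean a := Eη₁ < 0, and let T_n := η₁ + … + η_n. If G is strong subexponential (G ∈ S*), then P{T_n > x} ≤ (1 + o(1))·n·Ḡ(x) as x → ∞, uniformly in n ≥ 1; that is, limsup_{x→∞} sup_{n≥1} P{T_n > x}/(n·Ḡ(x)) ≤ 1. -/
open MeasureTheory Filter ProbabilityTheory

lemma ii_bdd {g : ℝ → ℝ} (hg : Measurable g) {C : ℝ} (hC : ∀ x, |g x| ≤ C) (a b : ℝ) :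
    IntervalIntegrable g volume a b := by
  refine (intervalIntegrable_const (c := C)).mono_fun hg.aestronglyMeasurable ?_
  refine Eventually.of_forall fun x => ?_
  simp only [Real.norm_eq_abs]
  exact (hC x).trans (le_abs_self C)

/-- integrability of the convolution integrand -/
lemma ii_conv {f : ℝ → ℝ} (hf : Antitone f) (h0 : ∀ x, 0 ≤ f x) (h1 : ∀ x, f x ≤ 1)
    (x a b : ℝ) : IntervalIntegrable (fun y => f (x - y) * f y) volume a b := by
  refine ii_bdd (C := 1) ?_ ?_ a b
  · exact (hf.measurable.comp (measurable_const.sub measurable_id)).mul hf.measurable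
  · intro y
    rw [abs_of_nonneg (mul_nonneg (h0 _) (h0 _))]
    exact mul_le_one₀ (h1 _) (h0 _) (h1 _)

lemma conv_tail_ge {f : ℝ → ℝ} (hf : Antitone f) (h0 : ∀ x, 0 ≤ f x) (h1 : ∀ x, f x ≤ 1)
    (x Q : ℝ) (hQ : 0 ≤ Q) :
    f x * (∫ y in (0:ℝ)..Q, f y) ≤ ∫ y in (x - Q)..x, f (x - y) * f y := by
  have e : ∫ y in (x - Q)..x, f (x - y) * f y = ∫ y in (0:ℝ)..Q, f (x - y) * f y := by
    have := intervalIntegral.integral_comp_sub_left (fun y => f (x - y) * f y) x (a := 0) (b := Q)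
    simp only [sub_zero] at this
    rw [← this]
    congr 1; ext y
    rw [sub_sub_cancel, mul_comm]
  rw [e, ← intervalIntegral.integral_const_mul]
  apply intervalIntegral.integral_mono_on hQ (hf.intervalIntegrable.const_mul _)
    (ii_conv hf h0 h1 x 0 Q)
  intro y hy
  exact mul_le_mul_of_nonneg_right (hf (by linarith [hy.1])) (h0 _)

lemma conv_split {f : ℝ → ℝ} (hf : Antitone f) (h0 : ∀ x, 0 ≤ f x) (h1 : ∀ x, f x ≤ 1)
    (x P R : ℝ) : ∫ y in (0:ℝ)..x, f (x - y) * f y = (∫ y in (0:ℝ)..P, f (x - y) * f y)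
      + (∫ y in P..R, f (x - y) * f y) + ∫ y in R..x, f (x - y) * f y := by
  rw [intervalIntegral.integral_add_adjacent_intervals (ii_conv hf h0 h1 x _ _)
    (ii_conv hf h0 h1 x _ _), intervalIntegral.integral_add_adjacent_intervals
    (ii_conv hf h0 h1 x _ _) (ii_conv hf h0 h1 x _ _)]

lemma long_tail {f : ℝ → ℝ} (hf : Antitone f) (hpos : ∀ x, 0 < f x) (h1 : ∀ x, f x ≤ 1) {m : ℝ}
    (hm : Tendsto (fun R => ∫ y in (0:ℝ)..R, f y) atTop (nhds m))
    (hS : ∀ δ > 0, ∃ X : ℝ, ∀ x ≥ X, ∫ y in (0:ℝ)..x, f (x - y) * f y ≤ (2 * m + δ) * f x)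
    (K : ℝ) (hK : 0 ≤ K) (δ : ℝ) (hδ : 0 < δ) : ∃ X : ℝ, ∀ x ≥ X, f (x - K) ≤ (1 + δ) * f x := by
  have h0 : ∀ x, 0 ≤ f x := fun x => (hpos x).le
  set κ := δ * f (K+1) / 3 with hκ
  have hκp : 0 < κ := by have := hpos (K+1); positivity
  obtain ⟨X, hX⟩ := hS κ hκp
  obtain ⟨R, hR1, hR2⟩ := ((hm.eventually (lt_mem_nhds (show m - κ < m by linarith))).and
    (eventually_ge_atTop (K+1))).exists
  refine ⟨max X (2 * R), fun x hx => ?_⟩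
  have hxX := hX x (le_trans (le_max_left _ _) hx)
  have hxR : 2 * R ≤ x := le_trans (le_max_right _ _) hx
  rw [conv_split hf h0 h1 x R (x - R)] at hxX
  have t := conv_tail_ge hf h0 h1 x R (by linarith)
  have mid : 0 ≤ ∫ y in R..(x-R), f (x - y) * f y :=
    intervalIntegral.integral_nonneg (by linarith) fun y _ => mul_nonneg (h0 _) (h0 _)
  have hd : 0 ≤ f (x - K) - f x := sub_nonneg.2 (hf (by linarith))
  have first : f x * (∫ y in (0:ℝ)..R, f y) + (f (x - K) - f x) * f (K+1)
      ≤ ∫ y in (0:ℝ)..R, f (x - y) * f y := by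
    rw [← intervalIntegral.integral_add_adjacent_intervals (ii_conv hf h0 h1 x 0 K)
      (ii_conv hf h0 h1 x K R), ← intervalIntegral.integral_add_adjacent_intervals
      (a := 0) (b := K) (c := R) hf.intervalIntegrable hf.intervalIntegrable]
    have e1 : f x * (∫ y in (0:ℝ)..K, f y) ≤ ∫ y in (0:ℝ)..K, f (x - y) * f y := by
      rw [← intervalIntegral.integral_const_mul]
      apply intervalIntegral.integral_mono_on hK (hf.intervalIntegrable.const_mul _)
        (ii_conv hf h0 h1 x _ _)
      intro y hy
      exact mul_le_mul_of_nonneg_right (hf (by linarith [hy.1])) (h0 _)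
    have e2 : f (x - K) * (∫ y in K..R, f y) ≤ ∫ y in K..R, f (x - y) * f y := by
      rw [← intervalIntegral.integral_const_mul]
      apply intervalIntegral.integral_mono_on (by linarith) (hf.intervalIntegrable.const_mul _)
        (ii_conv hf h0 h1 x _ _)
      intro y hy
      exact mul_le_mul_of_nonneg_right (hf (by linarith [hy.1])) (h0 _)
    have e3 : f (K+1) ≤ ∫ y in K..R, f y := by
      rw [← intervalIntegral.integral_add_adjacent_intervals
      (a := K) (b := K+1) (c := R) hf.intervalIntegrable hf.intervalIntegrable]
      have a1 : 0 ≤ ∫ y in (K+1)..R, f y := intervalIntegral.integral_nonneg hR2 fun y _ => h0 _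
      have a2 : ∫ y in K..(K+1), f (K+1) ≤ ∫ y in K..(K+1), f y := by
        apply intervalIntegral.integral_mono_on (by linarith) intervalIntegrable_const
          hf.intervalIntegrable
        intro y hy
        exact hf hy.2
      simp at a2
      linarith
    nlinarith [mul_le_mul_of_nonneg_left e3 hd]
  have key : (f (x - K) - f x) * f (K+1) ≤ (δ * f x) * f (K+1) := by
    have : f x * (m - κ) ≤ f x * (∫ y in (0:ℝ)..R, f y) :=
      mul_le_mul_of_nonneg_left hR1.le (h0 _)
    have : (f (x - K) - f x) * f (K+1) ≤ 3 * κ * f x := by linarith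
    have e : 3 * κ = δ * f (K+1) := by rw [hκ]; ring
    rw [e] at this
    linarith
  have := le_of_mul_le_mul_right key (hpos _)
  linarith

/-- The drift inequality. -/
lemma drift (ν : Measure ℝ) [IsProbabilityMeasure ν] (s u : ℝ → ℝ) (hs : Measurable s) (C : ℝ)
    (hs0 : ∀ x, 0 ≤ s x) (hsC : ∀ x, s x ≤ C) (hu : ∀ p q, u p - u q = ∫ t in p..q, s t)
    (hu0 : ∀ x, 0 ≤ u x) (x J B : ℝ) (hJ : 0 ≤ J) (hB : 0 ≤ B) :
    ∫ y in Set.Iic J, u (x - y) ∂ν ≤ u x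
      + (∫ z in (0:ℝ)..J, s (x - z) * (ν.real (Set.Ioi z) - ν.real (Set.Ioi J)))
      - ∫ z in (0:ℝ)..B, s (x + z) * ν.real (Set.Iio (-z)) := by
  have hsii : ∀ p q, IntervalIntegrable s volume p q := fun p q =>
    ii_bdd hs (C := C) (fun x => by rw [abs_of_nonneg (hs0 x)]; exact hsC x) p q
  have hC : 0 ≤ C := (hs0 0).trans (hsC 0)
  -- kernels
  set k1 : ℝ → ℝ → ℝ := fun y z => if z < y then s (x - z) else 0 with hk1
  set k2 : ℝ → ℝ → ℝ := fun y z => if y < -z then s (x + z) else 0 with hk2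
  have mk1 : Measurable (Function.uncurry k1) := by
    refine Measurable.ite (measurableSet_lt measurable_snd measurable_fst) ?_ measurable_const
    exact hs.comp (measurable_const.sub measurable_snd)
  have mk2 : Measurable (Function.uncurry k2) := by
    refine Measurable.ite (measurableSet_lt measurable_fst measurable_snd.neg) ?_ measurable_const
    exact hs.comp (measurable_const.add measurable_snd)
  have k1b : ∀ y z, |k1 y z| ≤ C := by
    intro y z
    simp only [hk1]; split_ifs
    · rw [abs_of_nonneg (hs0 _)]; exact hsC _
    · simpa using hC
  have k2b : ∀ y z, |k2 y z| ≤ C := by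
    intro y z
    simp only [hk2]; split_ifs
    · rw [abs_of_nonneg (hs0 _)]; exact hsC _
    · simpa using hC
  have k10 : ∀ y z, 0 ≤ k1 y z := by
    intro y z; simp only [hk1]; split_ifs; exacts [hs0 _, le_rfl]
  have k20 : ∀ y z, 0 ≤ k2 y z := by
    intro y z; simp only [hk2]; split_ifs; exacts [hs0 _, le_rfl]
  have pint1 : Integrable (Function.uncurry k1)
      ((ν.restrict (Set.Iic J)).prod (volume.restrict (Set.Ioc 0 J))) :=
    Integrable.of_bound mk1.aestronglyMeasurable C (Eventually.of_forall fun p => k1b p.1 p.2)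
  have pint2 : Integrable (Function.uncurry k2)
      ((ν.restrict (Set.Iic J)).prod (volume.restrict (Set.Ioc 0 B))) :=
    Integrable.of_bound mk2.aestronglyMeasurable C (Eventually.of_forall fun p => k2b p.1 p.2)
  have k1ii : ∀ y p q, IntervalIntegrable (k1 y) volume p q := fun y p q =>
    ii_bdd (mk1.comp (measurable_const.prodMk measurable_id)) (k1b y) p q
  have k2ii : ∀ y p q, IntervalIntegrable (k2 y) volume p q := fun y p q =>
    ii_bdd (mk2.comp (measurable_const.prodMk measurable_id)) (k2b y) p q
  have pw : ∀ y ∈ Set.Iic J, u (x - y) ≤ u x + (∫ z in Set.Ioc 0 J, k1 y z)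
      - ∫ z in Set.Ioc 0 B, k2 y z := by
    intro y hy
    have hyJ : y ≤ J := hy
    rw [← intervalIntegral.integral_of_le hJ, ← intervalIntegral.integral_of_le hB]
    rcases le_total 0 y with h | h
    · have z2 : ∫ z in (0:ℝ)..B, k2 y z = 0 := by
        rw [intervalIntegral.integral_congr (g := fun _ => (0:ℝ))]
        · simp
        · intro z hz
          rw [Set.uIcc_of_le hB] at hz
          simp only [hk2]
          rw [if_neg]; linarith [hz.1]
      have z1 : ∫ z in (0:ℝ)..y, s (x - z) ≤ ∫ z in (0:ℝ)..J, k1 y z := by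
        rw [← intervalIntegral.integral_add_adjacent_intervals (k1ii y 0 y) (k1ii y y J)]
        have a : 0 ≤ ∫ z in y..J, k1 y z := intervalIntegral.integral_nonneg hyJ fun z _ => k10 y z
        have b : ∫ z in (0:ℝ)..y, s (x - z) = ∫ z in (0:ℝ)..y, k1 y z := by
          apply intervalIntegral.integral_congr_ae
          have : ∀ᵐ z : ℝ, z ≠ y := by
            simp [ae_iff]
          filter_upwards [this] with z hz hz2
          rw [Set.uIoc_of_le h] at hz2
          simp only [hk1]
          rw [if_pos (lt_of_le_of_ne hz2.2 hz)]
        linarith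
      have e := hu (x - y) x
      rw [intervalIntegral.integral_comp_sub_left (fun t => s t) x] at z1
      simp only [sub_zero] at z1
      rw [z2]; linarith
    · have z1 : 0 ≤ ∫ z in (0:ℝ)..J, k1 y z := intervalIntegral.integral_nonneg hJ fun z _ => k10 y z
      have z2 : ∫ z in (0:ℝ)..B, k2 y z ≤ ∫ z in (0:ℝ)..(-y), s (x + z) := by
        have hshift : ∀ p q, IntervalIntegrable (fun z => s (x + z)) volume p q := fun p q =>
          ii_bdd (hs.comp (measurable_const.add measurable_id)) (C := C)
            (fun z => by
              show |s (x + z)| ≤ C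
              rw [abs_of_nonneg (hs0 _)]; exact hsC _) p q
        have big : ∫ z in (0:ℝ)..B, k2 y z ≤ ∫ z in (0:ℝ)..(max B (-y)), k2 y z := by
          rw [← intervalIntegral.integral_add_adjacent_intervals (k2ii y 0 B)
            (k2ii y B (max B (-y)))]
          have := intervalIntegral.integral_nonneg (μ := volume) (le_max_left B (-y))
            (fun z _ => k20 y z)
          linarith
        rw [← intervalIntegral.integral_add_adjacent_intervals (k2ii y 0 (-y))
            (k2ii y (-y) (max B (-y)))] at big
        have zz : ∫ z in (-y)..(max B (-y)), k2 y z = 0 := by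
          rw [intervalIntegral.integral_congr (g := fun _ => (0:ℝ))]
          · simp
          · intro z hz
            rw [Set.uIcc_of_le (le_max_right _ _)] at hz
            simp only [hk2]
            rw [if_neg]; linarith [hz.1]
        have z3 : ∫ z in (0:ℝ)..(-y), k2 y z ≤ ∫ z in (0:ℝ)..(-y), s (x + z) := by
          apply intervalIntegral.integral_mono_on (by linarith) (k2ii _ _ _) (hshift _ _)
          intro z _
          simp only [hk2]; split_ifs; exacts [le_rfl, hs0 _]
        linarith
      rw [intervalIntegral.integral_comp_add_left (fun t => s t) x] at z2
      have e := hu x (x - y)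
      simp only [add_zero, ← sub_eq_add_neg] at z2
      linarith
  have hmono : Antitone u := by
    intro p q hpq
    have := intervalIntegral.integral_nonneg (μ := volume) hpq (fun z _ => hs0 z)
    linarith [hu p q]
  have iu : Integrable (fun y => u (x - y)) (ν.restrict (Set.Iic J)) := by
    refine Integrable.of_bound (hmono.measurable.comp
      (measurable_const.sub measurable_id)).aestronglyMeasurable (u (x - J)) ?_
    filter_upwards [ae_restrict_mem measurableSet_Iic] with y hy
    rw [Real.norm_of_nonneg (hu0 _)]
    exact hmono (by have : y ≤ J := hy; linarith)
  have i1 := pint1.integral_prod_left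
  have i2 := pint2.integral_prod_left
  simp only [Function.uncurry_apply_pair] at i1 i2
  have main := setIntegral_mono_on iu (((integrable_const (u x)).add i1).sub i2)
    measurableSet_Iic pw
  refine main.trans ?_
  rw [integral_sub' ((integrable_const (u x)).add i1) i2, integral_add' (integrable_const (u x)) i1,
    integral_integral_swap pint1, integral_integral_swap pint2,
    ← intervalIntegral.integral_of_le hJ, ← intervalIntegral.integral_of_le hB]
  have c0 : ∫ y in Set.Iic J, u x ∂ν ≤ u x := by
    rw [setIntegral_const, smul_eq_mul]
    exact mul_le_of_le_one_left (hu0 _) measureReal_le_one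
  have c1 : ∫ z in (0:ℝ)..J, (∫ y in Set.Iic J, k1 y z ∂ν)
      = ∫ z in (0:ℝ)..J, s (x - z) * (ν.real (Set.Ioi z) - ν.real (Set.Ioi J)) := by
    apply intervalIntegral.integral_congr
    intro z hz
    rw [Set.uIcc_of_le hJ] at hz
    have : (fun y => k1 y z) = (Set.Ioi z).indicator (fun _ => s (x - z)) := by
      ext y; simp [hk1, Set.indicator_apply]
    simp only [this]
    rw [setIntegral_indicator measurableSet_Ioi, setIntegral_const, smul_eq_mul, mul_comm,
      ← measureReal_sdiff (Set.Ioi_subset_Ioi hz.2) measurableSet_Ioi]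
    congr 2; ext y; simp [and_comm]
  have c2 : ∫ z in (0:ℝ)..B, (∫ y in Set.Iic J, k2 y z ∂ν)
      = ∫ z in (0:ℝ)..B, s (x + z) * ν.real (Set.Iio (-z)) := by
    apply intervalIntegral.integral_congr
    intro z hz
    rw [Set.uIcc_of_le hB] at hz
    have : (fun y => k2 y z) = (Set.Iio (-z)).indicator (fun _ => s (x + z)) := by
      ext y; simp [hk2, Set.indicator_apply]
    simp only [this]
    rw [setIntegral_indicator measurableSet_Iio, setIntegral_const, smul_eq_mul, mul_comm]
    congr 2; ext y; simp only [Set.mem_inter_iff, Set.mem_Iic, Set.mem_Iio, and_iff_right_iff_imp]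
    intro h; linarith [hz.1]
  rw [c1, c2]; linarith

lemma int_le_lim {f : ℝ → ℝ} (hf : Antitone f) (h0 : ∀ x, 0 ≤ f x) {m : ℝ}
    (hm : Tendsto (fun R => ∫ y in (0:ℝ)..R, f y) atTop (nhds m)) (R : ℝ) :
    ∫ y in (0:ℝ)..R, f y ≤ m := by
  refine ge_of_tendsto hm ?_
  filter_upwards [eventually_ge_atTop R] with r hr
  rw [← intervalIntegral.integral_add_adjacent_intervals (a := 0) (b := R) (c := r)
    hf.intervalIntegrable hf.intervalIntegrable]
  have := intervalIntegral.integral_nonneg (μ := volume) hr (fun z _ => h0 z)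
  linarith

lemma fine_bound {f Fm : ℝ → ℝ} (hf : Antitone f) (hpos : ∀ x, 0 < f x) (h1 : ∀ x, f x ≤ 1) {m : ℝ}
    (hm : Tendsto (fun R => ∫ y in (0:ℝ)..R, f y) atTop (nhds m))
    (hS : ∀ δ > 0, ∃ X : ℝ, ∀ x ≥ X, ∫ y in (0:ℝ)..x, f (x - y) * f y ≤ (2 * m + δ) * f x)
    (hF : Antitone Fm) (hF0 : ∀ x, 0 ≤ Fm x) (hF1 : ∀ x, Fm x ≤ 1) (b B0 : ℝ)
    (hDR : m - ∫ y in (0:ℝ)..B0, Fm y ≤ -b)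
    (A : ℝ) (hA : 0 ≤ A) (ε : ℝ) (hε : 0 < ε) :
    ∃ B : ℝ, 0 ≤ B ∧ ∃ δ > 0, ∃ Y : ℝ, ∀ x ≥ Y, ∀ (s : ℝ → ℝ) (C σ : ℝ), Measurable s → 0 ≤ C →
      (∀ t, 0 ≤ s t) → (∀ t, s t ≤ C * f t) → 0 ≤ σ →
      (∀ z, |z| ≤ B → |s (x + z) - σ| ≤ δ * C * f x) →
      (∫ z in (0:ℝ)..(x - A), s (x - z) * (f z - f (x - A)))
        - (∫ z in (0:ℝ)..B, s (x + z) * Fm z) ≤ -b * σ + C * ε * f x := by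
  have h0 : ∀ x, 0 ≤ f x := fun x => (hpos x).le
  set κ := ε / 12 with hκ
  have hκp : 0 < κ := by positivity
  obtain ⟨X, hX⟩ := hS κ hκp
  obtain ⟨B, hB1, hB2⟩ := ((hm.eventually (lt_mem_nhds (show m - κ < m by linarith))).and
    (eventually_ge_atTop (max B0 A))).exists
  have hBA : A ≤ B := (le_max_right _ _).trans hB2
  have hBB : B0 ≤ B := (le_max_left _ _).trans hB2
  have hB : 0 ≤ B := hA.trans hBA
  have hm0 : 0 ≤ m := by simpa using int_le_lim hf h0 hm 0
  have hδ : 0 < ε / (2 * (m + B + 1)) := by positivity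
  obtain ⟨X2, hX2⟩ := long_tail hf hpos h1 hm hS B hB (ε / (4 * (B + 1))) (by positivity)
  refine ⟨B, hB, _, hδ, max (max X X2) (2 * B), ?_⟩
  intro x hx s C σ hsm hC hs0 hsC hσ hsσ
  have hxX := hX x (((le_max_left _ _).trans (le_max_left _ _)).trans hx)
  have hxX2 := hX2 x (((le_max_right _ _).trans (le_max_left _ _)).trans hx)
  have hxB : 2 * B ≤ x := (le_max_right _ _).trans hx
  set δ := ε / (2 * (m + B + 1)) with hδe
  have hsb : ∀ t, |s t| ≤ C := fun t => by
    rw [abs_of_nonneg (hs0 t)]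
    exact (hsC t).trans (mul_le_of_le_one_right hC (h1 t))
  -- integrability
  have ia : ∀ p q, IntervalIntegrable (fun z => s (x - z) * (f z - f (x - A))) volume p q := by
    intro p q
    refine ii_bdd (C := C * 1) ?_ ?_ p q
    · exact (hsm.comp (measurable_const.sub measurable_id)).mul (hf.measurable.sub measurable_const)
    · intro z
      rw [abs_mul]
      refine mul_le_mul (hsb _) ?_ (abs_nonneg _) hC
      rw [abs_le]; constructor <;> linarith [h0 z, h1 z, h0 (x - A), h1 (x - A)]
  have ib : ∀ p q, IntervalIntegrable (fun z => s (x + z) * Fm z) volume p q := by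
    intro p q
    refine ii_bdd (C := C * 1) ?_ ?_ p q
    · exact (hsm.comp (measurable_const.add measurable_id)).mul hF.measurable
    · intro z
      rw [abs_mul]
      refine mul_le_mul (hsb _) ?_ (abs_nonneg _) hC
      rw [abs_le]; constructor <;> linarith [hF0 z, hF1 z]
  set η := δ * C * f x with hη
  have hη0 : 0 ≤ η := mul_nonneg (mul_nonneg hδ.le hC) (h0 x)
  have p1 : ∫ z in (0:ℝ)..B, s (x - z) * (f z - f (x - A)) ≤ (σ + η) * m := by
    have : ∫ z in (0:ℝ)..B, s (x - z) * (f z - f (x - A)) ≤ ∫ z in (0:ℝ)..B, (σ + η) * f z := by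
      apply intervalIntegral.integral_mono_on hB (ia _ _) (hf.intervalIntegrable.const_mul _)
      intro z hz
      have hz' := hsσ (-z) (by rw [abs_neg, abs_of_nonneg hz.1]; exact hz.2)
      rw [← sub_eq_add_neg] at hz'
      have h2 := (abs_le.1 hz').2
      calc s (x - z) * (f z - f (x - A)) ≤ s (x - z) * f z :=
            mul_le_mul_of_nonneg_left (by linarith [h0 (x - A)]) (hs0 _)
        _ ≤ _ := mul_le_mul_of_nonneg_right (by linarith) (h0 _)
    refine this.trans ?_
    rw [intervalIntegral.integral_const_mul]
    exact mul_le_mul_of_nonneg_left (int_le_lim hf h0 hm B) (by linarith)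
  have p2 : ∫ z in B..(x - B), s (x - z) * (f z - f (x - A)) ≤ C * (3 * κ * f x) := by
    have : ∫ z in B..(x-B), s (x - z) * (f z - f (x - A))
        ≤ ∫ z in B..(x-B), C * (f (x - z) * f z) := by
      apply intervalIntegral.integral_mono_on (by linarith) (ia _ _)
        ((ii_conv hf h0 h1 x _ _).const_mul _)
      intro z hz
      calc s (x - z) * (f z - f (x - A)) ≤ s (x - z) * f z :=
            mul_le_mul_of_nonneg_left (by linarith [h0 (x - A)]) (hs0 _)
        _ ≤ (C * f (x - z)) * f z := mul_le_mul_of_nonneg_right (hsC _) (h0 _)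
        _ = _ := by ring
    refine this.trans ?_
    rw [intervalIntegral.integral_const_mul]
    refine mul_le_mul_of_nonneg_left ?_ hC
    rw [conv_split hf h0 h1 x B (x - B)] at hxX
    have t := conv_tail_ge hf h0 h1 x B hB
    have e1 : f x * (∫ y in (0:ℝ)..B, f y) ≤ ∫ y in (0:ℝ)..B, f (x - y) * f y := by
      rw [← intervalIntegral.integral_const_mul]
      apply intervalIntegral.integral_mono_on hB (hf.intervalIntegrable.const_mul _)
        (ii_conv hf h0 h1 x _ _)
      intro y hy
      exact mul_le_mul_of_nonneg_right (hf (by linarith [hy.1])) (h0 _)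
    have : f x * (m - κ) ≤ f x * (∫ y in (0:ℝ)..B, f y) :=
      mul_le_mul_of_nonneg_left hB1.le (h0 _)
    linarith
  have p3 : ∫ z in (x - B)..(x - A), s (x - z) * (f z - f (x - A)) ≤ C * (ε / 4 * f x) := by
    have : ∫ z in (x-B)..(x-A), s (x - z) * (f z - f (x - A))
        ≤ ∫ z in (x-B)..(x-A), C * (ε / (4 * (B + 1)) * f x) := by
      apply intervalIntegral.integral_mono_on (by linarith) (ia _ _) intervalIntegrable_const
      intro z hz
      have a1 : f (x - A) ≤ f z := hf hz.2
      have a2 : f z ≤ f (x - B) := hf hz.1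
      have a3 : f x ≤ f (x - A) := hf (by linarith)
      refine mul_le_mul ((le_abs_self _).trans (hsb _)) (by linarith) (by linarith) hC
    refine this.trans ?_
    rw [intervalIntegral.integral_const, smul_eq_mul, mul_left_comm]
    refine mul_le_mul_of_nonneg_left ?_ hC
    rw [← mul_assoc]
    refine mul_le_mul_of_nonneg_right ?_ (h0 x)
    rw [mul_div_assoc', div_le_div_iff₀ (by positivity) (by norm_num)]
    nlinarith
  have p4 : (σ - η) * (∫ z in (0:ℝ)..B, Fm z) ≤ ∫ z in (0:ℝ)..B, s (x + z) * Fm z := by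
    rw [← intervalIntegral.integral_const_mul]
    apply intervalIntegral.integral_mono_on hB (hF.intervalIntegrable.const_mul _) (ib _ _)
    intro z hz
    have hz' := hsσ z (by rw [abs_of_nonneg hz.1]; exact hz.2)
    exact mul_le_mul_of_nonneg_right (by linarith [(abs_le.1 hz').1]) (hF0 _)
  have p5 : ∫ z in (0:ℝ)..B0, Fm z ≤ ∫ z in (0:ℝ)..B, Fm z := by
    rw [← intervalIntegral.integral_add_adjacent_intervals (a := 0) (b := B0) (c := B)
      hF.intervalIntegrable hF.intervalIntegrable]
    have := intervalIntegral.integral_nonneg (μ := volume) hBB (fun z _ => hF0 z)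
    linarith
  have p6 : ∫ z in (0:ℝ)..B, Fm z ≤ B := by
    have : ∫ z in (0:ℝ)..B, Fm z ≤ ∫ z in (0:ℝ)..B, (1:ℝ) :=
      intervalIntegral.integral_mono_on hB hF.intervalIntegrable intervalIntegrable_const
        fun z _ => hF1 z
    simpa using this
  rw [← intervalIntegral.integral_add_adjacent_intervals (ia 0 B) (ia B (x - A)),
    ← intervalIntegral.integral_add_adjacent_intervals (ia B (x - B)) (ia (x - B) (x - A))]
  set M := ∫ z in (0:ℝ)..B, Fm z
  have q1 : σ * (m - M) ≤ σ * (-b) := mul_le_mul_of_nonneg_left (by linarith) hσ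
  have q2 : η * (m + M) ≤ C * (ε / 2 * f x) := by
    have : η * (m + M) ≤ η * (m + B + 1) := mul_le_mul_of_nonneg_left (by linarith) hη0
    refine this.trans (le_of_eq ?_)
    rw [hη, hδe]; field_simp
  rw [hκ] at p2
  linarith

theorem core (ν : Measure ℝ) [IsProbabilityMeasure ν] {f Fm : ℝ → ℝ}
    (hfν : ∀ z, f z = ν.real (Set.Ioi z)) (hFν : ∀ z, Fm z = ν.real (Set.Iio (-z)))
    (hpos : ∀ x, 0 < f x) {m : ℝ}
    (hm : Tendsto (fun R => ∫ y in (0:ℝ)..R, f y) atTop (nhds m))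
    (hS : ∀ δ > 0, ∃ X : ℝ, ∀ x ≥ X, ∫ y in (0:ℝ)..x, f (x - y) * f y ≤ (2 * m + δ) * f x)
    (b B0 : ℝ) (hb : 0 < b) (hB0 : 0 ≤ B0) (hDR : m - ∫ y in (0:ℝ)..B0, Fm y ≤ -(2 * b))
    (S : ℕ → ℝ → ℝ) (hSa : ∀ n, Antitone (S n)) (hS0 : ∀ n x, 0 ≤ S n x) (hS1 : ∀ n x, S n x ≤ 1)
    (hSz : ∀ x, 0 ≤ x → S 0 x ≤ 0) (hSs : ∀ n x, S (n+1) x ≤ ∫ y, S n (x - y) ∂ν)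
    (ε : ℝ) (hε : 0 < ε) : ∃ x₀ : ℝ, ∀ x ≥ x₀, ∀ n : ℕ, S n x ≤ (1 + ε) * n * f x := by
  have hf : Antitone f := fun p q hpq => by
    rw [hfν, hfν]; exact measureReal_mono (Set.Ioi_subset_Ioi hpq)
  have h1 : ∀ x, f x ≤ 1 := fun x => by rw [hfν]; exact measureReal_le_one
  have h0 : ∀ x, 0 ≤ f x := fun x => (hpos x).le
  have hF : Antitone Fm := fun p q hpq => by
    rw [hFν, hFν]; exact measureReal_mono (Set.Iio_subset_Iio (by linarith))
  have hF1 : ∀ x, Fm x ≤ 1 := fun x => by rw [hFν]; exact measureReal_le_one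
  have hF0 : ∀ x, 0 ≤ Fm x := fun x => by rw [hFν]; exact measureReal_nonneg
  have hm0 : 0 ≤ m := by simpa using int_le_lim hf h0 hm 0
  have LT := long_tail hf hpos h1 hm hS
  set c := 1 + ε with hc
  have hcp : 0 < c := by linarith
  set M0 := ∫ y in (0:ℝ)..B0, Fm y with hM0
  have hM0p : 0 ≤ M0 := intervalIntegral.integral_nonneg hB0 fun z _ => hF0 z
  -- coarse constants
  obtain ⟨δ0, hδ0, hδ01, hδ0c⟩ : ∃ δ0 : ℝ, 0 < δ0 ∧ δ0 ≤ 1 ∧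
      m + δ0 - (1 - δ0) * (1 - δ0) * M0 ≤ -b := by
    refine ⟨min 1 (b / (1 + 2 * M0)), by positivity, min_le_left _ _, ?_⟩
    set d := min 1 (b / (1 + 2 * M0))
    have : d * (1 + 2 * M0) ≤ b := by
      rw [← le_div_iff₀ (by positivity)]; exact min_le_right _ _
    nlinarith [mul_nonneg (sq_nonneg d) hM0p]
  obtain ⟨X1, hX1⟩ := hS (δ0 / 2) (by positivity)
  obtain ⟨X2, hX2⟩ := LT B0 hB0 δ0 hδ0
  obtain ⟨A, hA1, hA2⟩ := ((hm.eventually (lt_mem_nhds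
    (show m - δ0 / 2 < m by linarith))).and (eventually_ge_atTop (max 0 (max X1 X2)))).exists
  have hA : 0 ≤ A := (le_max_left _ _).trans hA2
  have hAX1 : X1 ≤ A := ((le_max_left _ _).trans (le_max_right _ _)).trans hA2
  have hAX2 : X2 ≤ A := ((le_max_right _ _).trans (le_max_right _ _)).trans hA2
  have C1 : ∀ x ≥ A, ∫ z in (0:ℝ)..(x - A), f (x - z) * f z ≤ (m + δ0) * f x := by
    intro x hx
    have h := hX1 x (hAX1.trans hx)
    have t := conv_tail_ge hf h0 h1 x A hA
    rw [← intervalIntegral.integral_add_adjacent_intervals (ii_conv hf h0 h1 x 0 (x - A))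
      (ii_conv hf h0 h1 x (x - A) x)] at h
    have : f x * (m - δ0 / 2) ≤ f x * ∫ y in (0:ℝ)..A, f y :=
      mul_le_mul_of_nonneg_left hA1.le (h0 x)
    linarith
  have C2 : ∀ x ≥ A, (1 - δ0) * f x ≤ f (x + B0) := by
    intro x hx
    have h := hX2 (x + B0) (by linarith)
    rw [add_sub_cancel_right] at h
    nlinarith [h0 (x + B0), mul_le_mul_of_nonneg_left h (sub_nonneg.2 hδ01),
      mul_nonneg (sq_nonneg δ0) (h0 (x + B0))]
  obtain ⟨K1, hK1, hK1p⟩ : ∃ K1 : ℝ, (∀ x ≥ A, f (x - A) ≤ K1 * f x) ∧ 0 ≤ K1 := by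
    obtain ⟨X, hX⟩ := LT A hA 1 one_pos
    refine ⟨2 + 1 / f X, fun x hx => ?_, by have := hpos X; positivity⟩
    have hp := hpos X
    rcases le_total X x with h | h
    · have := hX x h
      have : 0 ≤ 1 / f X * f x := by have := h0 x; positivity
      linarith
    · have a : f X ≤ f x := hf h
      have : 1 ≤ 1 / f X * f x := by
        rw [one_div_mul_eq_div, le_div_iff₀ hp]; linarith
      linarith [h1 (x - A), h0 x]
  set L := ((c / b) * (m + δ0) + K1) / b with hL
  have hLp : 0 ≤ L := by positivity
  set C := c / b + L with hC
  have hCp : 0 < C := by positivity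
  -- fine constants
  obtain ⟨B, hB, δ, hδ, Y1, hY1⟩ := fine_bound hf hpos h1 hm hS hF hF0 hF1 b B0 (by linarith)
    A hA (ε / (4 * C)) (by positivity)
  obtain ⟨X3, hX3⟩ := LT A hA (ε / 4) (by positivity)
  obtain ⟨X4, hX4⟩ := LT b hb.le (ε / (4 * c)) (by positivity)
  obtain ⟨X5, hX5⟩ := LT B hB (δ / 2) (by positivity)
  obtain ⟨Y, hY⟩ : ∃ Y : ℝ, Y1 ≤ Y ∧ X3 ≤ Y ∧ X4 ≤ Y ∧ X5 ≤ Y ∧ A ≤ Y ∧ 0 ≤ Y := by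
    refine ⟨max Y1 (max X3 (max X4 (max X5 (max A 0)))), ?_⟩
    simp only [le_max_iff, le_refl, true_or, or_true, and_self]
  obtain ⟨hYY1, hYX3, hYX4, hYX5, hYA, hY0⟩ := hY
  obtain ⟨W, hW0, hW1, hW2⟩ : ∃ W : ℝ, 0 < W ∧ Y + B0 ≤ δ0 * W ∧ B ≤ δ / 2 * W := by
    refine ⟨(Y + B0) / δ0 + B / (δ / 2) + 1, by positivity, ?_, ?_⟩
    · have : (Y + B0) = δ0 * ((Y + B0) / δ0) := by field_simp
      have h2 : 0 ≤ B / (δ / 2) := by positivity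
      nlinarith
    · have : B = δ / 2 * (B / (δ / 2)) := by field_simp
      have h2 : 0 ≤ (Y + B0) / δ0 := by positivity
      nlinarith
  set ψ : ℝ → ℝ := fun y => max 0 (min 1 (1 - y / W)) with hψ
  have hψ0 : ∀ y, 0 ≤ ψ y := fun y => le_max_left _ _
  have hψ1 : ∀ y, ψ y ≤ 1 := fun y => max_le zero_le_one (min_le_left _ _)
  have hψm : Measurable ψ := by
    have : Continuous ψ := by fun_prop
    exact this.measurable
  have hψW : ∀ y, W ≤ y → ψ y = 0 := by
    intro y hy
    have : 1 ≤ y / W := by rw [le_div_iff₀ hW0]; linarith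
    simp only [hψ]
    exact max_eq_left ((min_le_right _ _).trans (by linarith))
  have hψY : ∀ y, y ≤ Y + B0 → 1 - δ0 ≤ ψ y := by
    intro y hy
    have : y / W ≤ δ0 := by rw [div_le_iff₀ hW0]; linarith
    exact le_max_of_le_right (le_min (by linarith) (by linarith))
  have hψL : ∀ x z, |z| ≤ B → |ψ (x + z) - ψ x| ≤ δ / 2 := by
    intro x z hz
    have e : |ψ (x + z) - ψ x| ≤ |(1 - (x + z) / W) - (1 - x / W)| := by
      simp only [hψ]
      rw [max_comm 0, max_comm 0, min_comm 1, min_comm 1]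
      refine (abs_max_sub_max_le_abs _ _ _).trans ?_
      refine (abs_min_sub_min_le_max _ _ _ _).trans ?_
      simp
    refine e.trans ?_
    have : (1 - (x + z) / W) - (1 - x / W) = - (z / W) := by ring
    rw [this, abs_neg, abs_div, abs_of_pos hW0, div_le_iff₀ hW0]
    linarith
  -- the test functions
  set s : ℕ → ℝ → ℝ := fun n t => c / b * (f t - f (t + n * b)) + L * (ψ t * f t) with hs
  set u : ℕ → ℝ → ℝ := fun n x => c / b * (∫ t in x..(x + n * b), f t)
    + L * ∫ t in x..W, ψ t * f t with hu
  have hcb : 0 < c / b := by positivity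
  have hnb : ∀ n : ℕ, 0 ≤ (n:ℝ) * b := fun n => by positivity
  have hsm : ∀ n, Measurable (s n) := fun n =>
    ((hf.measurable.sub (hf.measurable.comp (measurable_id.add_const _))).const_mul _).add
      ((hψm.mul hf.measurable).const_mul _)
  have hs0 : ∀ n t, 0 ≤ s n t := fun n t => by
    have a : f (t + n * b) ≤ f t := hf (by linarith [hnb n])
    exact add_nonneg (mul_nonneg hcb.le (by linarith))
      (mul_nonneg hLp (mul_nonneg (hψ0 _) (h0 _)))
  have hsC : ∀ n t, s n t ≤ C * f t := fun n t => by
    have a : c / b * (f t - f (t + n * b)) ≤ c / b * f t :=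
      mul_le_mul_of_nonneg_left (by linarith [h0 (t + n * b)]) hcb.le
    have a2 : L * (ψ t * f t) ≤ L * f t :=
      mul_le_mul_of_nonneg_left (mul_le_of_le_one_left (h0 _) (hψ1 _)) hLp
    rw [hC, add_mul]; exact add_le_add a a2
  have hψf : ∀ p q, IntervalIntegrable (fun t => ψ t * f t) volume p q := fun p q =>
    ii_bdd (hψm.mul hf.measurable) (C := 1) (fun t => by
      show |ψ t * f t| ≤ 1
      rw [abs_of_nonneg (mul_nonneg (hψ0 _) (h0 _))]
      exact mul_le_one₀ (hψ1 _) (h0 _) (h1 _)) p q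
  have hg : ∀ x, 0 ≤ ∫ t in x..W, ψ t * f t := by
    intro x
    rcases le_total x W with h | h
    · exact intervalIntegral.integral_nonneg h fun z _ => mul_nonneg (hψ0 _) (h0 _)
    · rw [intervalIntegral.integral_congr (g := fun _ => (0:ℝ))]
      · simp
      · intro z hz
        rw [Set.uIcc_of_ge h] at hz
        simp [hψW z hz.1]
  have hu0 : ∀ n x, 0 ≤ u n x := fun n x => by
    have := intervalIntegral.integral_nonneg (μ := volume)
      (show x ≤ x + n * b by linarith [hnb n]) (fun z _ => h0 z)
    exact add_nonneg (mul_nonneg hcb.le this) (mul_nonneg hLp (hg x))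
  have hfi : ∀ p q, IntervalIntegrable f volume p q := fun p q => hf.intervalIntegrable
  have hus : ∀ n p q, u n p - u n q = ∫ t in p..q, s n t := by
    intro n p q
    have i2 : IntervalIntegrable (fun t => f (t + n * b)) volume p q :=
      (hf.comp_monotone (fun a b h => by simpa using h : Monotone (fun t : ℝ => t + n * b))).intervalIntegrable
    simp only [hs, hu]
    rw [intervalIntegral.integral_add (((hfi p q).sub i2).const_mul _) ((hψf p q).const_mul _),
      intervalIntegral.integral_const_mul, intervalIntegral.integral_const_mul,
      intervalIntegral.integral_sub (hfi p q) i2,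
      intervalIntegral.integral_comp_add_right (fun t => f t)]
    have e1 := intervalIntegral.integral_add_adjacent_intervals (hfi p q) (hfi q (q + n * b))
    have e2 := intervalIntegral.integral_add_adjacent_intervals (hfi p (p + n*b))
      (hfi (p + n * b) (q + n * b))
    have e3 := intervalIntegral.integral_add_adjacent_intervals (hψf p q) (hψf q W)
    rw [← e3]
    have : (∫ t in p..(p + n * b), f t) = (∫ t in p..q, f t) + (∫ t in q..(q + n*b), f t)
      - ∫ t in (p + n * b)..(q + n * b), f t := by linarith
    rw [this]; ring
  have hustep : ∀ n x, u n x + c * f (x + n * b + b) ≤ u (n+1) x := by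
    intro n x
    simp only [hu]
    have e2 := intervalIntegral.integral_add_adjacent_intervals (hfi x (x + n*b))
      (hfi (x + n * b) (x + n * b + b))
    have e3 : x + ((n + 1 : ℕ) : ℝ) * b = x + n * b + b := by push_cast; ring
    rw [e3, ← e2]
    have : ∫ t in (x + n * b)..(x + n * b + b), f (x + n * b + b)
        ≤ ∫ t in (x + n * b)..(x + n * b + b), f t :=
      intervalIntegral.integral_mono_on (by linarith) intervalIntegrable_const (hfi _ _)
        fun z hz => hf hz.2
    rw [intervalIntegral.integral_const, smul_eq_mul, add_sub_cancel_left] at this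
    have h2 := mul_le_mul_of_nonneg_left this hcb.le
    have h3 : c / b * (b * f (x + n * b + b)) = c * f (x + n * b + b) := by field_simp
    rw [h3] at h2
    linarith
  have hufin : ∀ n x, W ≤ x → u n x ≤ c * n * f x := by
    intro n x hx
    have z : ∫ t in x..W, ψ t * f t = 0 := by
      rw [intervalIntegral.integral_congr (g := fun _ => (0:ℝ))]
      · simp
      · intro z hz
        rw [Set.uIcc_of_ge hx] at hz
        simp [hψW z hz.1]
    have : ∫ t in x..(x + n * b), f t ≤ ∫ t in x..(x + n * b), f x :=
      intervalIntegral.integral_mono_on (by linarith [hnb n]) (hfi _ _) intervalIntegrable_const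
        fun z hz => hf hz.1
    rw [intervalIntegral.integral_const, smul_eq_mul, add_sub_cancel_left] at this
    have h2 := mul_le_mul_of_nonneg_left this hcb.le
    have h3 : c / b * (n * b * f x) = c * n * f x := by field_simp
    simp only [hu]
    rw [z]; linarith
  -- the one step inequality
  have step : ∀ n x, A ≤ x → (∫ y in Set.Iic (x - A), u n (x - y) ∂ν) + f (x - A) ≤ u (n+1) x := by
    intro n x hx
    have hJ : 0 ≤ x - A := by linarith
    have hst := hustep n x
    have hdr : ∀ B : ℝ, (0:ℝ) ≤ B → _ := fun B hB => drift ν (s n) (u n) (hsm n) C (hs0 n)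
      (fun t => (hsC n t).trans (mul_le_of_le_one_right hCp.le (h1 t))) (hus n) (hu0 n) x (x - A) B
      hJ hB
    simp only [← hfν, ← hFν] at hdr
    rcases le_total x Y with hxY | hxY
    · have hd := hdr B0 hB0
      have p1 : ∫ z in (0:ℝ)..(x - A), s n (x - z) * (f z - f (x - A)) ≤ C * ((m + δ0) * f x) := by
        refine le_trans ?_ (mul_le_mul_of_nonneg_left (C1 x hx) hCp.le)
        rw [← intervalIntegral.integral_const_mul]
        apply intervalIntegral.integral_mono_on hJ ?_ ((ii_conv hf h0 h1 x _ _).const_mul _)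
        · intro z hz
          calc s n (x - z) * (f z - f (x - A)) ≤ s n (x - z) * f z :=
                mul_le_mul_of_nonneg_left (by linarith [h0 (x - A)]) (hs0 _ _)
            _ ≤ (C * f (x - z)) * f z := mul_le_mul_of_nonneg_right (hsC _ _) (h0 _)
            _ = _ := by ring
        · refine ii_bdd (C := C * 1) ?_ ?_ _ _
          · exact ((hsm n).comp (measurable_const.sub measurable_id)).mul
              (hf.measurable.sub measurable_const)
          · intro z
            rw [abs_mul]
            refine mul_le_mul ?_ ?_ (abs_nonneg _) hCp.le
            · rw [abs_of_nonneg (hs0 _ _)]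
              exact (hsC _ _).trans (mul_le_of_le_one_right hCp.le (h1 _))
            · rw [abs_le]; constructor <;> linarith [h0 z, h1 z, h0 (x - A), h1 (x - A)]
      have p2 : L * ((1 - δ0) * (1 - δ0) * f x) * M0 ≤ ∫ z in (0:ℝ)..B0, s n (x + z) * Fm z := by
        rw [hM0, ← intervalIntegral.integral_const_mul]
        apply intervalIntegral.integral_mono_on hB0 (hF.intervalIntegrable.const_mul _)
        · refine ii_bdd (C := C * 1) ?_ ?_ _ _
          · exact ((hsm n).comp (measurable_const.add measurable_id)).mul hF.measurable
          · intro z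
            rw [abs_mul]
            refine mul_le_mul ?_ ?_ (abs_nonneg _) hCp.le
            · rw [abs_of_nonneg (hs0 _ _)]
              exact (hsC _ _).trans (mul_le_of_le_one_right hCp.le (h1 _))
            · rw [abs_le]; constructor <;> linarith [hF0 z, hF1 z]
        · intro z hz
          refine mul_le_mul_of_nonneg_right ?_ (hF0 z)
          have a : f (x + z + n * b) ≤ f (x + z) := hf (by linarith [hnb n])
          have a1 : (1 - δ0) * f x ≤ f (x + z) := (C2 x hx).trans (hf (by linarith [hz.2]))
          have a2 := hψY (x + z) (by linarith [hz.2])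
          have a3 : (1 - δ0) * ((1 - δ0) * f x) ≤ ψ (x + z) * f (x + z) :=
            mul_le_mul a2 a1 (mul_nonneg (by linarith) (h0 x)) (hψ0 _)
          have a4 := mul_le_mul_of_nonneg_left a3 hLp
          have a5 : 0 ≤ c / b * (f (x + z) - f (x + z + n * b)) :=
            mul_nonneg hcb.le (by linarith)
          simp only [hs]
          linarith
      have p3 := hK1 x hx
      have p4 : 0 ≤ c * f (x + n * b + b) := mul_nonneg hcp.le (h0 _)
      have p5 : L * b = (c / b) * (m + δ0) + K1 := by rw [hL]; field_simp
      have p6 : L * f x * (m + δ0 - (1 - δ0) * (1 - δ0) * M0) ≤ L * f x * (-b) :=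
        mul_le_mul_of_nonneg_left hδ0c (mul_nonneg hLp (h0 x))
      have p7 : L * f x * (-b) = - ((c / b) * (m + δ0) + K1) * f x := by rw [← p5]; ring
      have p8 : C * ((m + δ0) * f x) = (c / b) * (m + δ0) * f x + L * f x * (m + δ0) := by
        rw [hC]; ring
      linarith
    · have hd := hdr B hB
      set q := f (x + n * b) with hq
      have hqf : q ≤ f x := hf (by linarith [hnb n])
      have near : ∀ t, Y ≤ t → ∀ z, |z| ≤ B → |f (t + z) - f t| ≤ δ / 2 * f t := by
        intro t ht z hz
        have hz' := abs_le.1 hz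
        have a1 := hX5 t (by linarith)
        have a2 : f (t + z) ≤ f (t - B) := hf (by linarith)
        have a3 := hX5 (t + B) (by linarith)
        rw [add_sub_cancel_right] at a3
        have a4 : f (t + B) ≤ f (t + z) := hf (by linarith)
        have a5 : f (t + B) ≤ f t := hf (by linarith)
        have a6 := mul_le_mul_of_nonneg_left a5 (show 0 ≤ δ / 2 by positivity)
        rw [abs_le]; constructor <;> linarith
      have hf1 := hY1 x (by linarith) (s n) C (c / b * (f x - q) + L * (ψ x * f x)) (hsm n) hCp.le
        (hs0 n) (hsC n) (add_nonneg (mul_nonneg hcb.le (by linarith))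
        (mul_nonneg hLp (mul_nonneg (hψ0 _) (h0 _)))) (by
          intro z hz
          have n1 := abs_le.1 (near x hxY z hz)
          have n2 := abs_le.1 (near (x + n * b) (by linarith [hnb n]) z hz)
          have n3 := abs_le.1 (hψL x z hz)
          have g1 := mul_le_mul_of_nonneg_left hqf (show 0 ≤ δ / 2 by positivity)
          have g2 := hψ0 (x + z)
          have g3 := hψ1 (x + z)
          have g4 : 0 ≤ δ / 2 * f x := mul_nonneg (by positivity) (h0 x)
          have k1 : |(f (x + z) - f (x + n * b + z)) - (f x - q)| ≤ δ * f x := by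
            rw [abs_le]; constructor <;> linarith
          have k2 : |ψ (x + z) * f (x + z) - ψ x * f x| ≤ δ * f x := by
            have e : ψ (x + z) * f (x + z) - ψ x * f x
              = ψ (x + z) * (f (x + z) - f x) + (ψ (x + z) - ψ x) * f x := by ring
            rw [e]
            refine (abs_add_le _ _).trans ?_
            rw [abs_mul, abs_mul, abs_of_nonneg g2, abs_of_nonneg (h0 x)]
            have r1 : ψ (x + z) * |f (x + z) - f x| ≤ 1 * (δ / 2 * f x) :=
              mul_le_mul g3 (near x hxY z hz) (abs_nonneg _) zero_le_one
            have r2 := mul_le_mul_of_nonneg_right (hψL x z hz) (h0 x)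
            linarith
          have e : s n (x + z) - (c / b * (f x - q) + L * (ψ x * f x))
              = c / b * ((f (x + z) - f (x + n * b + z)) - (f x - q))
              + L * (ψ (x + z) * f (x + z) - ψ x * f x) := by
            simp only [hs]
            rw [add_right_comm x z]; ring
          rw [e]
          refine (abs_add_le _ _).trans ?_
          rw [abs_mul, abs_mul, abs_of_pos hcb, abs_of_nonneg hLp]
          have r1 := mul_le_mul_of_nonneg_left k1 hcb.le
          have r2 := mul_le_mul_of_nonneg_left k2 hLp
          have r3 : δ * C * f x = c / b * (δ * f x) + L * (δ * f x) := by rw [hC]; ring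
          linarith)
      have e1 := hX3 x (by linarith)
      have e2 := hX4 (x + n * b + b) (by linarith [hnb n])
      rw [add_sub_cancel_right, ← hq] at e2
      have e3 : b * (c / b * (f x - q)) = c * (f x - q) := by field_simp
      have e4 : 0 ≤ b * (L * (ψ x * f x)) :=
        mul_nonneg hb.le (mul_nonneg hLp (mul_nonneg (hψ0 _) (h0 _)))
      have e5 : C * (ε / (4 * C)) * f x = ε / 4 * f x := by field_simp
      have e6 : c * (ε / (4 * c) * f (x + n * b + b)) = ε / 4 * f (x + n * b + b) := by field_simp
      have e7 : f (x + n * b + b) ≤ f x := hf (by linarith [hnb n])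
      have e8 := mul_le_mul_of_nonneg_left e2 hcp.le
      have e9 : c * f x = f x + ε * f x := by rw [hc]; ring
      have e10 := mul_le_mul_of_nonneg_left e7 (show 0 ≤ ε / 4 by positivity)
      have e11 : 0 ≤ ε * f x := mul_nonneg hε.le (h0 x)
      rw [e5] at hf1
      linarith
  have huanti : ∀ n, Antitone (u n) := by
    intro n p q hpq
    have := intervalIntegral.integral_nonneg (μ := volume) hpq (fun z _ => hs0 n z)
    linarith [hus n p q]
  have ind : ∀ n x, A ≤ x → S n x ≤ u n x := by
    intro n
    induction n with
    | zero => exact fun x hx => (hSz x (hA.trans hx)).trans (hu0 0 x)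
    | succ n ih =>
      intro x hx
      refine (hSs n x).trans (le_trans ?_ (step n x hx))
      have iS : Integrable (fun y => S n (x - y)) ν := by
        refine Integrable.of_bound ((hSa n).measurable.comp
          (measurable_const.sub measurable_id)).aestronglyMeasurable 1 ?_
        exact Eventually.of_forall fun y => by
          rw [Real.norm_of_nonneg (hS0 _ _)]; exact hS1 _ _
      have iu : Integrable (fun y => u n (x - y)) (ν.restrict (Set.Iic (x - A))) := by
        refine Integrable.of_bound ((huanti n).measurable.comp
          (measurable_const.sub measurable_id)).aestronglyMeasurable (u n A) ?_
        filter_upwards [ae_restrict_mem measurableSet_Iic] with y hy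
        rw [Real.norm_of_nonneg (hu0 _ _)]
        exact huanti n (by have : y ≤ x - A := hy; linarith)
      rw [← integral_add_compl (measurableSet_Iic (a := x - A)) iS]
      refine add_le_add ?_ ?_
      · refine setIntegral_mono_on iS.integrableOn iu measurableSet_Iic fun y hy => ih _ ?_
        have : y ≤ x - A := hy
        linarith
      · rw [Set.compl_Iic, hfν]
        refine (setIntegral_mono iS.integrableOn (integrable_const (1:ℝ)) fun y => hS1 _ _).trans ?_
        simp
  refine ⟨max A W, fun x hx n => ?_⟩
  exact (ind n x ((le_max_left _ _).trans hx)).trans (hufin n x ((le_max_right _ _).trans hx))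

theorem sums_strong_subexponential_upper
    {Ω : Type*} [MeasurableSpace Ω] (μ : Measure Ω) [IsProbabilityMeasure μ]
    (η : ℕ → Ω → ℝ)
    (hmeas : ∀ i, Measurable (η i))
    (hindep : iIndepFun η μ)
    (hident : ∀ i, Measure.map (η i) μ = Measure.map (η 0) μ)
    (hint : Integrable (η 0) μ)
    (T : ℕ → Ω → ℝ) (hT : ∀ n ω, T n ω = ∑ i ∈ Finset.range n, η i ω)
    (Gbar : ℝ → ℝ) (hGbar : ∀ x, Gbar x = (μ {ω | x < η 0 ω}).toReal)
    -- negative mean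
    (ha : ∫ ω, η 0 ω ∂μ < 0)
    -- `G` is strong subexponential
    (hSstar : Tendsto
      (fun x => (∫ y in (0:ℝ)..x, Gbar (x - y) * Gbar y) /
        (2 * (∫ y in Set.Ioi (0:ℝ), Gbar y) * Gbar x)) atTop (nhds 1)) :
    ∀ ε > (0 : ℝ), ∃ x₀ : ℝ, ∀ x ≥ x₀, ∀ n : ℕ, 1 ≤ n →
      (μ {ω | x < T n ω}).toReal ≤ (1 + ε) * n * Gbar x := by
  set ν := Measure.map (η 0) μ with hν
  have : IsProbabilityMeasure ν := Measure.isProbabilityMeasure_map (hmeas 0).aemeasurable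
  have hfν : ∀ z, Gbar z = ν.real (Set.Ioi z) := by
    intro z
    rw [hGbar, measureReal_def, hν, Measure.map_apply (hmeas 0) measurableSet_Ioi]
    rfl
  have hf : Antitone Gbar := fun p q hpq => by
    rw [hfν, hfν]; exact measureReal_mono (Set.Ioi_subset_Ioi hpq)
  have h0 : ∀ x, 0 ≤ Gbar x := fun x => by rw [hfν]; exact measureReal_nonneg
  set m := ∫ y in Set.Ioi (0:ℝ), Gbar y with hm
  have hev := hSstar.eventually (lt_mem_nhds (show (0:ℝ) < 1 by norm_num))
  have hne : ∀ᶠ x in atTop, Gbar x ≠ 0 ∧ m ≠ 0 := by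
    filter_upwards [hev] with x hx
    constructor
    · intro h; simp [h] at hx
    · intro h; simp [h] at hx
  have hm0 : m ≠ 0 := by
    obtain ⟨x, hx⟩ := hne.exists
    exact hx.2
  have hmp : 0 < m := lt_of_le_of_ne (integral_nonneg fun y => h0 y) hm0.symm
  have hpos : ∀ x, 0 < Gbar x := by
    intro x
    obtain ⟨y, hy, hxy⟩ := (hne.and (eventually_ge_atTop x)).exists
    exact (lt_of_le_of_ne (h0 y) hy.1.symm).trans_le (hf hxy)
  have hInt : IntegrableOn Gbar (Set.Ioi 0) := by
    by_contra h
    exact hm0 (integral_undef h)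
  have hlim : Tendsto (fun R => ∫ y in (0:ℝ)..R, Gbar y) atTop (nhds m) :=
    intervalIntegral_tendsto_integral_Ioi 0 hInt tendsto_id
  have hS : ∀ δ > 0, ∃ X : ℝ, ∀ x ≥ X,
      ∫ y in (0:ℝ)..x, Gbar (x - y) * Gbar y ≤ (2 * m + δ) * Gbar x := by
    intro δ hδ
    have := hSstar.eventually (gt_mem_nhds (show (1:ℝ) < 1 + δ / (2 * m) by
      have : 0 < δ / (2 * m) := by positivity
      linarith))
    obtain ⟨X, hX⟩ := eventually_atTop.1 this
    refine ⟨X, fun x hx => ?_⟩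
    have h := hX x hx
    have hp := hpos x
    rw [div_lt_iff₀ (by positivity)] at h
    refine h.le.trans (le_of_eq ?_)
    field_simp
  -- the mean
  set Fm : ℝ → ℝ := fun z => ν.real (Set.Iio (-z)) with hFm
  have hFμ : ∀ z, Fm z = μ.real {ω | z < -η 0 ω} := by
    intro z
    simp only [hFm, measureReal_def, hν]
    rw [Measure.map_apply (hmeas 0) measurableSet_Iio]
    congr 2; ext ω; simp only [Set.mem_preimage, Set.mem_Iio, Set.mem_ofPred_eq]
    constructor <;> intro h <;> linarith
  have hmean : ∫ ω, η 0 ω ∂μ = m - ∫ z in Set.Ioi (0:ℝ), Fm z := by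
    have e1 : ∫ ω, max (η 0 ω) 0 ∂μ = m := by
      rw [hint.pos_part.integral_eq_integral_meas_lt (Eventually.of_forall fun ω => le_max_right _ _)]
      refine setIntegral_congr_fun measurableSet_Ioi fun t ht => ?_
      have ht' : (0:ℝ) < t := ht
      simp only [hGbar, measureReal_def]
      congr 2; ext ω; simp [ht'.le, ht'.not_gt]
    have e2 : ∫ ω, max (-η 0 ω) 0 ∂μ = ∫ z in Set.Ioi (0:ℝ), Fm z := by
      rw [hint.neg_part.integral_eq_integral_meas_lt (Eventually.of_forall fun ω => le_max_right _ _)]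
      refine setIntegral_congr_fun measurableSet_Ioi fun t ht => ?_
      have ht' : (0:ℝ) < t := ht
      simp only [hFμ, measureReal_def]
      congr 2; ext ω; simp [ht'.le, ht'.not_gt]
    rw [← e1, ← e2, ← integral_sub hint.pos_part hint.neg_part]
    congr 1; ext ω
    rcases le_total 0 (η 0 ω) with h | h
    · rw [max_eq_left h, max_eq_right (by linarith)]; ring
    · rw [max_eq_right h, max_eq_left (by linarith)]; ring
  set b := -(∫ ω, η 0 ω ∂μ) / 4 with hb
  have hbp : 0 < b := by rw [hb]; linarith
  have hFi : IntegrableOn Fm (Set.Ioi 0) := by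
    by_contra h
    rw [integral_undef h] at hmean
    linarith
  obtain ⟨B0, hB1, hB2⟩ := (((intervalIntegral_tendsto_integral_Ioi 0 hFi tendsto_id).eventually
    (lt_mem_nhds (show (∫ z in Set.Ioi (0:ℝ), Fm z) - b < ∫ z in Set.Ioi (0:ℝ), Fm z by
      linarith))).and (eventually_ge_atTop 0)).exists
  simp only [id] at hB1
  have hTm : ∀ n, Measurable (T n) := by
    intro n
    have : T n = fun ω => ∑ i ∈ Finset.range n, η i ω := funext (hT n)
    rw [this]
    exact Finset.measurable_fun_sum _ fun i _ => hmeas i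
  intro ε hε
  obtain ⟨x₀, hx₀⟩ := core ν hfν (fun z => rfl) hpos hlim hS b B0 hbp hB2 (by linarith)
    (fun n x => μ.real {ω | x < T n ω})
    (fun n p q hpq => measureReal_mono fun ω (h : q < T n ω) => lt_of_le_of_lt hpq h)
    (fun n x => measureReal_nonneg) (fun n x => measureReal_le_one)
    (by
      intro x hx
      have : {ω | x < T 0 ω} = ∅ := by
        ext ω; simp [hT, hx]
      simp [this])
    (by
      intro n x
      have hind : IndepFun (T n) (η n) μ := by
        have := hindep.indepFun_finsetSum_of_notMem hmeas (s := Finset.range n) (i := n) (by simp)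
        have e : T n = ∑ i ∈ Finset.range n, η i := by
          ext ω; simp [hT]
        rw [e]; exact this
      have hprod := (indepFun_iff_map_prod_eq_prod_map_map (hTm n).aemeasurable
        (hmeas n).aemeasurable).1 hind
      rw [hident n] at hprod
      have : IsProbabilityMeasure (Measure.map (T n) μ) :=
        Measure.isProbabilityMeasure_map (hTm n).aemeasurable
      have hset : MeasurableSet {p : ℝ × ℝ | x < p.1 + p.2} :=
        measurableSet_lt measurable_const (measurable_fst.add measurable_snd)
      have e1 : μ {ω | x < T (n+1) ω} = ((Measure.map (T n) μ).prod ν) {p | x < p.1 + p.2} := by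
        rw [← hprod, Measure.map_apply ((hTm n).prodMk (hmeas n)) hset]
        congr 1; ext ω
        simp [hT, Finset.sum_range_succ]
      have e2 : ∀ y, (Measure.map (T n) μ) ((fun t => (t, y)) ⁻¹' {p : ℝ × ℝ | x < p.1 + p.2})
          = μ {ω | x - y < T n ω} := by
        intro y
        rw [Measure.map_apply (hTm n) (measurable_prodMk_right hset)]
        congr 1; ext ω
        simp [sub_lt_iff_lt_add]
      rw [measureReal_def, e1, Measure.prod_apply_symm hset]
      simp only [e2]
      refine le_of_eq ?_
      simp only [measureReal_def]
      rw [integral_toReal]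
      · have : Antitone fun t => μ {ω | t < T n ω} :=
          fun p q hpq => measure_mono fun ω (h : q < T n ω) => lt_of_le_of_lt hpq h
        exact (this.measurable.comp (measurable_const.sub measurable_id)).aemeasurable
      · exact Eventually.of_forall fun y => measure_lt_top _ _)
    ε hε
  exact ⟨x₀, fun x hx n _ => hx₀ x hx n⟩
end

section
/- Let η₁, η₂, … be i.i.d. with common distribution G such that Eη₁ = 0, E{η₁²; η₁ ≤ 0} < ∞, and G is dominated varying, and let T_n := η₁ + … + η_n. If E{η₁^{1+δ}; η₁ > 0} < ∞ for some δ ∈ (0,1), then for every δ′ ∈ (0, δ) there exists c < ∞ such that P{T_n > x} ≤ c·n·Ḡ(x) for all x > 0 and all n ≤ x^{1+δ′}. -/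
open MeasureTheory Filter ProbabilityTheory

lemma aux_exp (r : ℝ) (hr1 : 1 ≤ r) (hr2 : r ≤ 2) (L u : ℝ) (hL : 0 ≤ L) (hu : u ≤ L) :
    Real.exp u ≤ 1 + u + |u| ^ r * Real.exp L := by
  have hL1 : 1 ≤ Real.exp L := Real.one_le_exp hL
  have hp : 0 ≤ |u| ^ r := Real.rpow_nonneg (abs_nonneg u) r
  have hle : |u| ^ r ≤ |u| ^ r * Real.exp L := le_mul_of_one_le_right hp hL1
  rcases le_total |u| 1 with h | h
  · have h1 := Real.abs_exp_sub_one_sub_id_le h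
    have h2 := (abs_le.mp h1).2
    have h3 : u ^ 2 ≤ |u| ^ r := by
      rcases eq_or_lt_of_le (abs_nonneg u) with h0 | h0
      · have : u = 0 := abs_eq_zero.mp h0.symm
        rw [this] at hp ⊢
        simpa using hp
      · have h4 := Real.rpow_le_rpow_of_exponent_ge h0 h hr2
        rw [Real.rpow_two, sq_abs] at h4
        exact h4
    linarith
  · have h1 : 1 ≤ |u| ^ r := Real.one_le_rpow h (by linarith)
    have h2 : |u| ≤ |u| ^ r := by
      simpa using Real.rpow_le_rpow_of_exponent_le h hr1
    rcases le_total 0 u with h0 | h0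
    · have : Real.exp u ≤ Real.exp L := Real.exp_le_exp.mpr hu
      have : Real.exp L ≤ |u| ^ r * Real.exp L := le_mul_of_one_le_left (by positivity) h1
      linarith
    · have : Real.exp u ≤ 1 := Real.exp_le_one_iff.mpr h0
      rw [abs_of_nonpos h0] at *
      linarith

lemma aux_mgf {Ω : Type*} [MeasurableSpace Ω] (μ : Measure Ω) [IsProbabilityMeasure μ]
    (X : Ω → ℝ) (hX : Measurable X) (hint : Integrable X μ) (h0 : ∫ ω, X ω ∂μ = 0)
    (r : ℝ) (hr1 : 1 ≤ r) (hr2 : r ≤ 2) (hr : Integrable (fun ω => |X ω| ^ r) μ)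
    (l y : ℝ) (hl : 0 ≤ l) (hy : 0 ≤ y) :
    Integrable (fun ω => Real.exp (l * min (X ω) y)) μ ∧
    mgf (fun ω => min (X ω) y) μ l ≤
      Real.exp (l ^ r * Real.exp (l * y) * ∫ ω, |X ω| ^ r ∂μ) := by
  have hmi : Integrable (fun ω => min (X ω) y) μ := hint.inf (integrable_const y)
  have hE : Integrable (fun ω => Real.exp (l * min (X ω) y)) μ := by
    refine Integrable.mono' (integrable_const (Real.exp (l * y))) ?_ ?_
    · exact (by fun_prop : Measurable _).aestronglyMeasurable
    · refine Eventually.of_forall fun ω => ?_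
      rw [Real.norm_eq_abs, Real.abs_exp, Real.exp_le_exp]
      exact mul_le_mul_of_nonneg_left (min_le_right _ _) hl
  refine ⟨hE, ?_⟩
  have hm0 : ∫ ω, min (X ω) y ∂μ ≤ 0 := by
    rw [← h0]
    exact integral_mono hmi hint fun ω => min_le_left _ _
  have hpt : ∀ ω, Real.exp (l * min (X ω) y) ≤
      1 + l * min (X ω) y + (l ^ r * Real.exp (l * y)) * |X ω| ^ r := by
    intro ω
    have h1 := aux_exp r hr1 hr2 (l * y) (l * min (X ω) y) (by positivity)
      (mul_le_mul_of_nonneg_left (min_le_right _ _) hl)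
    have h2 : |l * min (X ω) y| ^ r ≤ l ^ r * |X ω| ^ r := by
      rw [abs_mul, abs_of_nonneg hl, Real.mul_rpow hl (abs_nonneg _)]
      have : |min (X ω) y| ≤ |X ω| := by
        rcases le_total (X ω) y with h | h
        · rw [min_eq_left h]
        · rw [min_eq_right h, abs_of_nonneg hy]
          exact h.trans (le_abs_self _)
      gcongr
    have h3 := mul_le_mul_of_nonneg_right h2 (Real.exp_nonneg (l * y))
    nlinarith
  have h4 : mgf (fun ω => min (X ω) y) μ l ≤
      ∫ ω, (1 + l * min (X ω) y + (l ^ r * Real.exp (l * y)) * |X ω| ^ r) ∂μ := by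
    unfold mgf
    exact integral_mono hE (((integrable_const 1).add (hmi.const_mul l)).add (hr.const_mul _)) hpt
  have h5 : ∫ ω, (1 + l * min (X ω) y + (l ^ r * Real.exp (l * y)) * |X ω| ^ r) ∂μ
      = 1 + l * ∫ ω, min (X ω) y ∂μ + (l ^ r * Real.exp (l * y)) * ∫ ω, |X ω| ^ r ∂μ := by
    have hi1 : Integrable (fun ω => 1 + l * min (X ω) y) μ :=
      (integrable_const 1).add (hmi.const_mul l)
    rw [integral_add hi1 (hr.const_mul _),
      integral_add (integrable_const 1) (hmi.const_mul l), integral_const_mul, integral_const_mul]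
    simp
  have h6 : l * ∫ ω, min (X ω) y ∂μ ≤ 0 := mul_nonpos_of_nonneg_of_nonpos hl hm0
  have h7 := Real.add_one_le_exp (l ^ r * Real.exp (l * y) * ∫ ω, |X ω| ^ r ∂μ)
  linarith

lemma aux_sum {Ω : Type*} [MeasurableSpace Ω] (μ : Measure Ω) [IsProbabilityMeasure μ]
    (η : ℕ → Ω → ℝ)
    (hmeas : ∀ i, Measurable (η i))
    (hindep : iIndepFun η μ)
    (hident : ∀ i, Measure.map (η i) μ = Measure.map (η 0) μ)
    (hint : Integrable (η 0) μ) (h0 : ∫ ω, η 0 ω ∂μ = 0)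
    (r : ℝ) (hr1 : 1 ≤ r) (hr2 : r ≤ 2) (hr : Integrable (fun ω => |η 0 ω| ^ r) μ)
    (l y x : ℝ) (hl : 0 ≤ l) (hy : 0 ≤ y) (n : ℕ) :
    μ.real {ω | x < ∑ i ∈ Finset.range n, η i ω} ≤
      n * μ.real {ω | y < η 0 ω} +
      Real.exp (-l * x + n * (l ^ r * Real.exp (l * y) * ∫ ω, |η 0 ω| ^ r ∂μ)) := by
  set Y : ℕ → Ω → ℝ := fun i ω => min (η i ω) y with hY
  have hid : ∀ i, IdentDistrib (η i) (η 0) μ μ := fun i =>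
    ⟨(hmeas i).aemeasurable, (hmeas 0).aemeasurable, hident i⟩
  have hYm : ∀ i, Measurable (Y i) := fun i => (hmeas i).min measurable_const
  have hYi : iIndepFun Y μ :=
    hindep.comp (fun _ z => min z y) (fun _ => measurable_id.min measurable_const)
  have hYd : ∀ i, IdentDistrib (Y i) (Y 0) μ μ := fun i =>
    (hid i).comp (measurable_id.min measurable_const : Measurable fun z : ℝ => min z y)
  obtain ⟨hE0, hM⟩ := aux_mgf μ (η 0) (hmeas 0) hint h0 r hr1 hr2 hr l y hl hy
  have hEi : ∀ i, Integrable (fun ω => Real.exp (l * Y i ω)) μ := by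
    intro i
    have : IdentDistrib (fun ω => Real.exp (l * Y i ω)) (fun ω => Real.exp (l * Y 0 ω)) μ μ :=
      (hYd i).comp (by fun_prop : Measurable fun z : ℝ => Real.exp (l * z))
    exact this.integrable_iff.mpr hE0
  have hMi : ∀ i, mgf (Y i) μ l = mgf (Y 0) μ l := by
    intro i
    have : IdentDistrib (fun ω => Real.exp (l * Y i ω)) (fun ω => Real.exp (l * Y 0 ω)) μ μ :=
      (hYd i).comp (by fun_prop : Measurable fun z : ℝ => Real.exp (l * z))
    exact this.integral_eq
  have hch : μ.real {ω | x ≤ (∑ i ∈ Finset.range n, Y i) ω} ≤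
      Real.exp (-l * x + n * (l ^ r * Real.exp (l * y) * ∫ ω, |η 0 ω| ^ r ∂μ)) := by
    have h1 := measure_ge_le_exp_mul_mgf (μ := μ) (X := ∑ i ∈ Finset.range n, Y i) x hl
      (hYi.integrable_exp_mul_sum hYm (fun i _ => hEi i))
    rw [hYi.mgf_sum hYm, Finset.prod_congr rfl (fun i _ => hMi i), Finset.prod_const,
      Finset.card_range] at h1
    refine h1.trans ?_
    rw [Real.exp_add, Real.exp_nat_mul]
    gcongr
    exact mgf_nonneg
  have hsub : {ω | x < ∑ i ∈ Finset.range n, η i ω} ⊆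
      (⋃ i ∈ Finset.range n, {ω | y < η i ω}) ∪ {ω | x ≤ (∑ i ∈ Finset.range n, Y i) ω} := by
    intro ω hω
    by_cases h : ∃ i ∈ Finset.range n, y < η i ω
    · left
      obtain ⟨i, hi, h⟩ := h
      exact Set.mem_biUnion hi h
    · right
      push Not at h
      have : ∑ i ∈ Finset.range n, Y i ω = ∑ i ∈ Finset.range n, η i ω :=
        Finset.sum_congr rfl fun i hi => min_eq_left (h i hi)
      simp only [Set.mem_setOf_eq, Finset.sum_apply] at hω ⊢
      rw [this]
      exact hω.le
  have hb : μ.real (⋃ i ∈ Finset.range n, {ω | y < η i ω}) ≤ n * μ.real {ω | y < η 0 ω} := by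
    refine (measureReal_biUnion_finset_le _ _).trans ?_
    have : ∀ i ∈ Finset.range n, μ.real {ω | y < η i ω} = μ.real {ω | y < η 0 ω} := by
      intro i _
      have := (hid i).measure_mem_eq (measurableSet_Ioi (a := y))
      exact congrArg ENNReal.toReal this
    rw [Finset.sum_congr rfl this]
    simp
  calc _ ≤ _ := measureReal_mono hsub
    _ ≤ _ := measureReal_union_le _ _
    _ ≤ _ := add_le_add hb hch

lemma aux_analytic (A δ δ' M x n : ℝ) (hA : 0 ≤ A) (hδ0 : 0 < δ') (hδ1 : δ' < δ)
    (hM : 0 < M) (hx : 1 ≤ x) (hn0 : 0 ≤ n) (hn : n ≤ x ^ (1 + δ')) (l : ℝ)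
    (hl : l = (δ - δ') / 2 * M * Real.log x / x) :
    Real.exp (-l * x + n * (l ^ (1 + δ) * Real.exp (l * (x / M)) * A)) ≤
      Real.exp ((M * (1 + δ)) ^ (1 + δ) * A) * x ^ (-((δ - δ') / 2 * M)) := by
  have hx0 : 0 < x := by linarith
  set e := (δ - δ') / 2 with he
  have he0 : 0 < e := by rw [he]; linarith
  have hr : 0 < 1 + δ := by linarith
  have hlog : 0 ≤ Real.log x := Real.log_nonneg hx
  have h1 : -l * x = Real.log x * (-(e * M)) := by rw [hl]; field_simp
  have h2 : Real.exp (l * (x / M)) = x ^ e := by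
    rw [Real.rpow_def_of_pos hx0, hl]
    congr 1
    field_simp
  have h3 : l ≤ M * (1 + δ) * x ^ (e / (1 + δ) - 1) := by
    have := Real.log_le_rpow_div hx0.le (div_pos he0 hr)
    rw [hl, Real.rpow_sub_one hx0.ne']
    calc e * M * Real.log x / x ≤ e * M * (x ^ (e / (1 + δ)) / (e / (1 + δ))) / x := by gcongr
      _ = _ := by field_simp
  have hl0 : 0 ≤ l := by rw [hl]; positivity
  have h4 : l ^ (1 + δ) ≤ (M * (1 + δ)) ^ (1 + δ) * x ^ (e - (1 + δ)) := by
    calc l ^ (1 + δ) ≤ (M * (1 + δ) * x ^ (e / (1 + δ) - 1)) ^ (1 + δ) := by gcongr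
      _ = _ := by
        rw [Real.mul_rpow (by positivity) (by positivity), ← Real.rpow_mul hx0.le]
        congr 2
        field_simp
  have h5 : n * (l ^ (1 + δ) * x ^ e * A) ≤ (M * (1 + δ)) ^ (1 + δ) * A := by
    calc n * (l ^ (1 + δ) * x ^ e * A) ≤
        x ^ (1 + δ') * (((M * (1 + δ)) ^ (1 + δ) * x ^ (e - (1 + δ))) * x ^ e * A) := by gcongr
      _ = (M * (1 + δ)) ^ (1 + δ) * A * (x ^ (1 + δ') * x ^ (e - (1 + δ)) * x ^ e) := by ring
      _ = (M * (1 + δ)) ^ (1 + δ) * A := by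
        rw [← Real.rpow_add hx0, ← Real.rpow_add hx0,
          show 1 + δ' + (e - (1 + δ)) + e = 0 by rw [he]; ring]
        simp
  rw [h2, h1, Real.exp_add, Real.rpow_def_of_pos hx0 (-(e * M)), mul_comm]
  exact mul_le_mul_of_nonneg_right (Real.exp_le_exp.mpr h5) (Real.exp_nonneg _)

/-- For i.i.d. centred random variables whose common
distribution `G` is dominated varying, with `E{η²; η ≤ 0} < ∞` and
`E{η^{1+δ}; η > 0} < ∞` for some `δ ∈ (0,1)`: for every `δ' ∈ (0, δ)`
there exists `c < ∞` such that `ℙ(T_n > x) ≤ c n Ḡ(x)` for all `x > 0`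
and all `n ≤ x^{1+δ'}`. -/
theorem sums_regvar_rough_upper_first_moment
    {Ω : Type*} [MeasurableSpace Ω] (μ : Measure Ω) [IsProbabilityMeasure μ]
    (η : ℕ → Ω → ℝ)
    (hmeas : ∀ i, Measurable (η i))
    (hindep : iIndepFun η μ)
    (hident : ∀ i, Measure.map (η i) μ = Measure.map (η 0) μ)
    (hint : Integrable (η 0) μ)
    (T : ℕ → Ω → ℝ) (hT : ∀ n ω, T n ω = ∑ i ∈ Finset.range n, η i ω)
    (Gbar : ℝ → ℝ) (hGbar : ∀ x, Gbar x = (μ {ω | x < η 0 ω}).toReal)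
    -- zero mean
    (h0 : ∫ ω, η 0 ω ∂μ = 0)
    -- `E{η²; η ≤ 0} < ∞`
    (hneg2 : Integrable (fun ω => if η 0 ω ≤ 0 then (η 0 ω) ^ 2 else 0) μ)
    -- `G` is dominated varying
    (hDV : ∃ C : ℝ, ∀ x : ℝ, Gbar (x / 2) ≤ C * Gbar x)
    (δ : ℝ) (hδ0 : 0 < δ) (hδ1 : δ < 1)
    -- `E{η^{1+δ}; η > 0} < ∞`
    (hmom : Integrable (fun ω => if 0 < η 0 ω then (η 0 ω) ^ (1 + δ) else 0) μ) :
    ∀ δ' : ℝ, 0 < δ' → δ' < δ → ∃ c : ℝ, ∀ x > (0 : ℝ), ∀ n : ℕ,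
      (n : ℝ) ≤ x ^ (1 + δ') →
      (μ {ω | x < T n ω}).toReal ≤ c * n * Gbar x := by
  intro δ' hδ'0 hδ'1
  obtain ⟨C0, hC0⟩ := hDV
  have hGr : ∀ x, Gbar x = μ.real {ω | x < η 0 ω} := hGbar
  have hG0 : ∀ x, 0 ≤ Gbar x := fun x => by rw [hGr]; exact measureReal_nonneg
  have hGanti : Antitone Gbar := by
    intro a b hab
    rw [hGr, hGr]
    exact measureReal_mono fun ω (h : b < η 0 ω) => lt_of_le_of_lt hab h
  set C := max C0 2 with hCdef
  have hC2 : 2 ≤ C := le_max_right _ _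
  have hC : ∀ x, Gbar (x / 2) ≤ C * Gbar x := fun x =>
    (hC0 x).trans (mul_le_mul_of_nonneg_right (le_max_left _ _) (hG0 x))
  have hCk : ∀ (k : ℕ) x, Gbar (x / 2 ^ k) ≤ C ^ k * Gbar x := by
    intro k
    induction k with
    | zero => intro x; simp
    | succ k ih =>
      intro x
      calc Gbar (x / 2 ^ (k + 1)) = Gbar (x / 2 / 2 ^ k) := by rw [pow_succ']; congr 1; field_simp
        _ ≤ C ^ k * Gbar (x / 2) := ih _
        _ ≤ C ^ k * (C * Gbar x) := by gcongr; exact hC x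
        _ = _ := by ring
  have hTset : ∀ n x, (μ {ω | x < T n ω}).toReal =
      μ.real {ω | x < ∑ i ∈ Finset.range n, η i ω} := by
    intro n x
    simp only [hT]
    rfl
  rcases eq_or_lt_of_le (hG0 1) with hz | hpos
  · -- degenerate case
    refine ⟨0, fun x hx n _ => ?_⟩
    have hk0 : ∀ k : ℕ, μ {ω | 1 / 2 ^ k < η 0 ω} = 0 := by
      intro k
      have h1 := hCk k 1
      rw [← hz, mul_zero] at h1
      have h2 : μ.real {ω | 1 / 2 ^ k < η 0 ω} = 0 := by
        rw [← hGr]; exact le_antisymm h1 (hG0 _)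
      exact (measureReal_eq_zero_iff).mp h2
    have h3 : μ {ω | 0 < η 0 ω} = 0 := by
      refine measure_mono_null ?_ (measure_iUnion_null hk0)
      intro ω hω
      obtain ⟨k, hk⟩ := exists_pow_lt_of_lt_one (show (0:ℝ) < η 0 ω from hω)
        (by norm_num : (1/2 : ℝ) < 1)
      refine Set.mem_iUnion.mpr ⟨k, ?_⟩
      simpa using hk
    have h4 : ∀ i, μ {ω | 0 < η i ω} = 0 := by
      intro i
      have hid : IdentDistrib (η i) (η 0) μ μ :=
        ⟨(hmeas i).aemeasurable, (hmeas 0).aemeasurable, hident i⟩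
      exact (hid.measure_mem_eq (measurableSet_Ioi (a := (0:ℝ)))).trans h3
    have h5 : μ {ω | x < T n ω} = 0 := by
      refine measure_mono_null ?_ (measure_iUnion_null h4)
      intro ω hω
      by_contra hcon
      simp only [Set.mem_iUnion, Set.mem_setOf_eq, not_exists, not_lt] at hcon hω
      rw [hT] at hω
      have := Finset.sum_nonpos (s := Finset.range n) fun i _ => hcon i
      linarith
    rw [h5]
    simp
  · have hr : Integrable (fun ω => |η 0 ω| ^ (1 + δ)) μ := by
      refine Integrable.mono' ((hmom.add hneg2).add (integrable_const 1))
        (by have := hmeas 0; exact (by fun_prop : Measurable _).aestronglyMeasurable) ?_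
      refine Eventually.of_forall fun ω => ?_
      rw [Real.norm_eq_abs, abs_of_nonneg (by positivity)]
      simp only [Pi.add_apply]
      rcases lt_or_ge 0 (η 0 ω) with h | h
      · rw [if_pos h, if_neg (not_le.mpr h), abs_of_pos h]
        linarith
      · rw [if_neg (not_lt.mpr h), if_pos h]
        rcases le_total |η 0 ω| 1 with h1 | h1
        · have := Real.rpow_le_one (abs_nonneg _) h1 (by linarith : 0 ≤ 1 + δ)
          nlinarith [sq_nonneg (η 0 ω)]
        · have := Real.rpow_le_rpow_of_exponent_le h1 (by linarith : 1 + δ ≤ 2)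
          rw [Real.rpow_two, sq_abs] at this
          linarith
    set A := ∫ ω, |η 0 ω| ^ (1 + δ) ∂μ with hAdef
    have hA : 0 ≤ A := integral_nonneg fun ω => by positivity
    set γ := Real.logb 2 C with hγ
    have hlow : ∀ x, 1 ≤ x → x ^ (-γ) ≤ C / Gbar 1 * Gbar x := by
      intro x hx
      have hx0 : 0 < x := by linarith
      set k := ⌈Real.logb 2 x⌉₊ with hk
      have hk1 : x ≤ 2 ^ k := by
        have := Nat.le_ceil (Real.logb 2 x)
        rw [← hk, Real.logb_le_iff_le_rpow (by norm_num) hx0, Real.rpow_natCast] at this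
        exact this
      have hk2 : C ^ k ≤ C * x ^ γ := by
        have h1 := (Nat.ceil_lt_add_one (Real.logb_nonneg (by norm_num : (1:ℝ) < 2) hx)).le
        rw [← hk] at h1
        calc C ^ k = C ^ (k : ℝ) := (Real.rpow_natCast _ _).symm
          _ ≤ C ^ (Real.logb 2 x + 1) := Real.rpow_le_rpow_of_exponent_le (by linarith) h1
          _ = C * x ^ γ := by
            rw [Real.rpow_add_one (by linarith), mul_comm]
            congr 1
            rw [Real.rpow_def_of_pos (by linarith), Real.rpow_def_of_pos hx0, hγ, Real.logb,
              Real.logb]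
            congr 1
            ring
      have h2 : Gbar 1 ≤ C ^ k * Gbar x := by
        refine (hGanti ?_).trans (hCk k x)
        rw [div_le_one (by positivity)]
        exact hk1
      have h3 : Gbar 1 ≤ C * x ^ γ * Gbar x := h2.trans (mul_le_mul_of_nonneg_right hk2 (hG0 x))
      rw [Real.rpow_neg hx0.le, inv_le_iff_one_le_mul₀ (by positivity), div_mul_eq_mul_div,
        div_mul_eq_mul_div, le_div_iff₀ hpos]
      linarith
    obtain ⟨k, hk⟩ := pow_unbounded_of_one_lt (γ / ((δ - δ') / 2)) (by norm_num : (1:ℝ) < 2)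
    have he : 0 < (δ - δ') / 2 := by linarith
    rw [div_lt_iff₀ he] at hk
    set K := Real.exp ((2 ^ k * (1 + δ)) ^ (1 + δ) * A) with hK
    refine ⟨C ^ k + K * (C / Gbar 1), fun x hx n hn => ?_⟩
    rw [hTset]
    rcases Nat.eq_zero_or_pos n with h | hnpos
    · subst h
      have : {ω : Ω | x < ∑ i ∈ Finset.range 0, η i ω} = ∅ := by
        ext ω; simp [hx.le]
      rw [this]
      simp
    have hn1 : (1:ℝ) ≤ n := by exact_mod_cast hnpos
    have hx1 : 1 ≤ x := by
      by_contra hlt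
      push Not at hlt
      have := Real.rpow_lt_one hx.le hlt (by linarith : 0 < 1 + δ')
      linarith
    have hM : (0:ℝ) < 2 ^ k := by positivity
    have hlog := Real.log_nonneg hx1
    have h1 := aux_sum μ η hmeas hindep hident hint h0 (1 + δ) (by linarith) (by linarith) hr
      ((δ - δ') / 2 * 2 ^ k * Real.log x / x) (x / 2 ^ k) x (by positivity) (by positivity) n
    have h2 := aux_analytic A δ δ' (2 ^ k) x n hA hδ'0 hδ'1 hM hx1 (by positivity) hn _ rfl
    have h3 : x ^ (-((δ - δ') / 2 * 2 ^ k)) ≤ x ^ (-γ) :=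
      Real.rpow_le_rpow_of_exponent_le hx1 (by linarith)
    have h4 := hlow x hx1
    have h5 := hCk k x
    rw [← hGr] at h1
    have hCG : 0 ≤ C / Gbar 1 * Gbar x := (by positivity : 0 ≤ x ^ (-γ)).trans h4
    calc _ ≤ _ := h1
      _ ≤ n * (C ^ k * Gbar x) + K * x ^ (-((δ - δ') / 2 * 2 ^ k)) := by gcongr
      _ ≤ n * (C ^ k * Gbar x) + K * (C / Gbar 1 * Gbar x) := by
        gcongr; exact h3.trans h4
      _ ≤ n * (C ^ k * Gbar x) + n * (K * (C / Gbar 1 * Gbar x)) := by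
        refine add_le_add le_rfl ?_
        exact le_mul_of_one_le_left (mul_nonneg (Real.exp_nonneg _) hCG) hn1
      _ = _ := by ring
end

section
/- Let η₁, η₂, … be i.i.d. with common distribution G with Eη₁ = 0 and E|η₁|^k < ∞ for every k ≥ 1, and let T_n := η₁ + … + η_n. Write Ḡ(x) = e^{−R(x)} where R is the hazard function of G. Suppose that for every ε > 0 there exists x₀ such that R(x)/x ≤ (1+ε)·R(z)/z for all x ≥ z ≥ x₀. Then, for every ε ∈ (0,1), there exists c = c(ε) < ∞ such that P{T_n > x} ≤ (n+1)·Ḡ(y) for all x > 0, all y ≤ (1−ε)x, and all n satisfying n·R(y)/x² ≤ 1/c. -/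
open MeasureTheory Filter ProbabilityTheory

lemma aux_summable {Ω : Type*} [MeasurableSpace Ω] (μ : Measure Ω) [IsProbabilityMeasure μ]
    (X : Ω → ℝ)
    (hmom : ∀ k : ℕ, Integrable (fun ω => |X ω| ^ k) μ)
    (R : ℝ → ℝ) (hR : ∀ x, (μ {ω | x < X ω}).toReal = Real.exp (-R x))
    (θ : ℝ) (hθ : 0 < θ) :
    Summable (fun j : ℕ => ((j : ℝ) + 1) ^ 2 * Real.exp (-(θ * R j))) := by
  obtain ⟨k, hk⟩ := exists_nat_ge (4 / θ)
  have hk4 : 4 ≤ k * θ := by rwa [div_le_iff₀ hθ] at hk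
  set M := ∫ ω, |X ω| ^ k ∂μ with hM
  have hM0 : 0 ≤ M := integral_nonneg fun ω => by positivity
  rw [← summable_nat_add_iff 1]
  have hs : Summable (fun j : ℕ => 4 * M ^ θ * (1 / ((j + 1 : ℕ) : ℝ) ^ 2)) := by
    apply Summable.mul_left
    exact (summable_nat_add_iff 1).2 (Real.summable_one_div_nat_pow.2 (by norm_num))
  refine Summable.of_nonneg_of_le (fun j => by positivity) (fun j => ?_) hs
  set a : ℝ := ((j + 1 : ℕ) : ℝ) with ha
  have ha1 : 1 ≤ a := by rw [ha]; exact_mod_cast Nat.succ_le_succ (Nat.zero_le j)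
  have h1 : a ^ k * Real.exp (-R a) ≤ M := by
    have := mul_meas_ge_le_integral_of_nonneg (μ := μ) (f := fun ω => |X ω| ^ k)
      (Eventually.of_forall fun ω => by positivity) (hmom k) (a ^ k)
    refine le_trans ?_ this
    rw [← hR a]
    gcongr
    unfold Measure.real
    apply ENNReal.toReal_mono (measure_ne_top _ _)
    apply measure_mono
    intro ω hω
    simp only [Set.mem_ofPred_eq] at hω ⊢
    have : a ≤ |X ω| := hω.le.trans (le_abs_self _)
    gcongr
  have h2 : a ^ 4 * Real.exp (-(θ * R a)) ≤ M ^ θ := by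
    have h3 := Real.rpow_le_rpow (by positivity) h1 hθ.le
    refine le_trans ?_ h3
    rw [Real.mul_rpow (by positivity) (by positivity), ← Real.exp_mul, ← Real.rpow_natCast a k,
      ← Real.rpow_mul (by positivity), ← Real.rpow_natCast a 4]
    have : a ^ ((4:ℕ):ℝ) ≤ a ^ (k * θ) := Real.rpow_le_rpow_of_exponent_le ha1 (by exact_mod_cast hk4)
    have e : -(θ * R a) = -R a * θ := by ring
    rw [e]
    gcongr
  have h5 : (a + 1) ^ 2 ≤ 4 * a ^ 2 := by nlinarith
  calc (a + 1) ^ 2 * Real.exp (-(θ * R a)) ≤ 4 * a ^ 2 * Real.exp (-(θ * R a)) := by gcongr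
    _ = 4 * (a ^ 4 * Real.exp (-(θ * R a))) * (1 / a ^ 2) := by field_simp
    _ ≤ 4 * M ^ θ * (1 / a ^ 2) := by gcongr

lemma aux_dom {Ω : Type*} [MeasurableSpace Ω] (μ : Measure Ω) [IsProbabilityMeasure μ]
    (X : Ω → ℝ) (hX : Measurable X)
    (hmom : ∀ k : ℕ, Integrable (fun ω => |X ω| ^ k) μ)
    (R : ℝ → ℝ) (hR : ∀ x, (μ {ω | x < X ω}).toReal = Real.exp (-R x))
    (θ : ℝ) (hθ : 0 < θ) :
    Integrable (fun ω => if 0 < X ω then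
      (X ω) ^ 2 * Real.exp ((1 - θ) * R ((⌈X ω⌉₊ - 1 : ℕ) : ℝ)) else 0) μ := by
  have hmd : Measurable (fun ω => if 0 < X ω then
      (X ω) ^ 2 * Real.exp ((1 - θ) * R ((⌈X ω⌉₊ - 1 : ℕ) : ℝ)) else 0) := by
    refine Measurable.ite (measurableSet_lt measurable_const hX) ?_ measurable_const
    refine (hX.pow_const 2).mul ?_
    exact (measurable_from_nat (f := fun m : ℕ => Real.exp ((1 - θ) * R ((m - 1 : ℕ) : ℝ)))).comp
      (Nat.measurable_ceil.comp hX)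
  refine ⟨hmd.aestronglyMeasurable, ?_⟩
  rw [hasFiniteIntegral_iff_ofReal (Eventually.of_forall fun ω => by
    show (0:ℝ) ≤ _
    split_ifs <;> positivity)]
  let c : ℕ → ℝ := fun j => ((j : ℝ) + 1) ^ 2 * Real.exp ((1 - θ) * R j)
  have hle : ∀ ω, ENNReal.ofReal (if 0 < X ω then
      (X ω) ^ 2 * Real.exp ((1 - θ) * R ((⌈X ω⌉₊ - 1 : ℕ) : ℝ)) else 0) ≤
      ∑' j : ℕ, Set.indicator {ω | (j : ℝ) < X ω} (fun _ => ENNReal.ofReal (c j)) ω := by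
    intro ω
    split_ifs with h
    · have hc : 0 < ⌈X ω⌉₊ := Nat.ceil_pos.2 h
      obtain ⟨m, hm⟩ : ∃ m, ⌈X ω⌉₊ = m + 1 := ⟨⌈X ω⌉₊ - 1, by omega⟩
      have h1 : (m : ℝ) < X ω := Nat.lt_ceil.1 (by omega)
      have h2 : X ω ≤ m + 1 := by exact_mod_cast Nat.ceil_le.1 hm.le
      refine le_trans ?_ (ENNReal.le_tsum m)
      rw [Set.indicator_of_mem (by exact h1)]
      apply ENNReal.ofReal_le_ofReal
      rw [hm]
      simp only [c, Nat.add_sub_cancel]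
      gcongr
    · simp
  refine lt_of_le_of_lt (lintegral_mono hle) ?_
  rw [lintegral_tsum (fun j => (measurable_const.indicator
    (measurableSet_lt measurable_const hX)).aemeasurable)]
  have e : ∀ j : ℕ, ∫⁻ ω, Set.indicator {ω | (j : ℝ) < X ω} (fun _ => ENNReal.ofReal (c j)) ω ∂μ
      = ENNReal.ofReal (((j : ℝ) + 1) ^ 2 * Real.exp (-(θ * R j))) := by
    intro j
    rw [lintegral_indicator_const (measurableSet_lt measurable_const hX),
      ← ENNReal.ofReal_toReal (measure_ne_top μ _), hR,
      ← ENNReal.ofReal_mul (by positivity)]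
    congr 1
    simp only [c]
    rw [mul_assoc, ← Real.exp_add]
    ring_nf
  simp_rw [e]
  exact (aux_summable μ X hmom R hR θ hθ).tsum_ofReal_lt_top

lemma aux_exp_s13 (t : ℝ) : Real.exp t ≤ 1 + t + t ^ 2 * Real.exp (max t 0) := by
  rcases le_or_gt t 0 with h | h
  · rw [max_eq_right h, Real.exp_zero]
    have h1 := Real.add_one_le_exp (-t)
    have h2 : Real.exp t * Real.exp (-t) = 1 := by rw [← Real.exp_add]; simp
    have h3 := Real.exp_pos t
    have h4 : Real.exp t * (1 - t) ≤ 1 := by nlinarith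
    have h5 : Real.exp t ≤ 1 / (1 - t) := by rw [le_div_iff₀ (by linarith)]; exact h4
    refine h5.trans ?_
    rw [div_le_iff₀ (by linarith)]
    nlinarith [mul_nonneg (sq_nonneg t) (neg_nonneg.2 h)]
  · rw [max_eq_left h.le]
    have h1 := Real.add_one_le_exp (-t)
    have h2 : Real.exp t * Real.exp (-t) = 1 := by rw [← Real.exp_add]; simp
    have h3 := Real.exp_pos t
    -- (1 - t) e^t ≤ 1
    have h4 : Real.exp t * (1 - t) ≤ 1 := by nlinarith
    have h5 : Real.exp t ≤ 1 + t * Real.exp t := by nlinarith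
    nlinarith

lemma aux_lam (s lam Ry y Rj j z : ℝ) (hs : 0 < s) (hs1 : s < 1) (hl : lam ≤ (1 - s) * (Ry / y))
    (h : Ry / y ≤ (1 + s / 4) * Rj / j) (hz : 0 < z) (hzj : z ≤ j + 1) (hj : 4 ≤ s * j)
    (hRj : 0 ≤ Rj) : lam * z ≤ (1 - s / 2) * Rj := by
  have hj0 : 0 < j := by
    by_contra hh
    nlinarith
  have h1 : z ≤ (1 + s / 4) * j := by nlinarith
  have h2 : lam ≤ (1 - s) * ((1 + s / 4) * Rj / j) :=
    hl.trans (mul_le_mul_of_nonneg_left h (by linarith))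
  have h20 : 0 ≤ (1 - s) * ((1 + s / 4) * Rj / j) := by
    have : 0 ≤ 1 - s := by linarith
    positivity
  calc lam * z ≤ (1 - s) * ((1 + s / 4) * Rj / j) * z := by gcongr
    _ ≤ (1 - s) * ((1 + s / 4) * Rj / j) * ((1 + s / 4) * j) := by gcongr
    _ = ((1 - s) * (1 + s / 4) ^ 2) * Rj := by field_simp
    _ ≤ (1 - s / 2) * Rj := by
      gcongr
      nlinarith [sq_nonneg s, pow_pos hs 3]

lemma aux_cheb {Ω : Type*} [MeasurableSpace Ω] (μ : Measure Ω) [IsProbabilityMeasure μ]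
    (η : ℕ → Ω → ℝ) (hmeas : ∀ i, Measurable (η i)) (hindep : iIndepFun η μ)
    (hident : ∀ i, Measure.map (η i) μ = Measure.map (η 0) μ)
    (h0 : ∫ ω, η 0 ω ∂μ = 0) (h2 : MemLp (η 0) 2 μ) (n : ℕ) (x : ℝ) (hx : 0 < x) :
    (μ {ω | x < ∑ i ∈ Finset.range n, η i ω}).toReal ≤ n * variance (η 0) μ / x ^ 2 := by
  have hid : ∀ i, IdentDistrib (η i) (η 0) μ μ := fun i =>
    ⟨(hmeas i).aemeasurable, (hmeas 0).aemeasurable, hident i⟩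
  have hL : ∀ i, MemLp (η i) 2 μ := fun i => (hid i).memLp_iff.2 h2
  have hv : variance (∑ i ∈ Finset.range n, η i) μ = n * variance (η 0) μ := by
    rw [IndepFun.variance_sum (fun i _ => hL i) (fun i _ j _ hij => hindep.indepFun hij)]
    simp [fun i => (hid i).variance_eq]
  have hm : ∫ ω, (∑ i ∈ Finset.range n, η i) ω ∂μ = 0 := by
    simp only [Finset.sum_apply]
    rw [integral_finsetSum _ (fun i _ => (hL i).integrable (by norm_num))]
    exact Finset.sum_eq_zero fun i _ => by rw [(hid i).integral_eq, h0]
  have hLs : MemLp (∑ i ∈ Finset.range n, η i) 2 μ := memLp_finsetSum' _ fun i _ => hL i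
  have hc := meas_ge_le_variance_div_sq hLs hx
  rw [hm, hv] at hc
  refine ENNReal.toReal_le_of_le_ofReal ?_ (le_trans (measure_mono ?_) hc)
  · have := variance_nonneg (η 0) μ
    positivity
  · intro ω hω
    simp only [Set.mem_ofPred_eq, Finset.sum_apply, sub_zero] at hω ⊢
    exact hω.le.trans (le_abs_self _)

lemma aux_chern {Ω : Type*} [MeasurableSpace Ω] (μ : Measure Ω) [IsProbabilityMeasure μ]
    (η : ℕ → Ω → ℝ) (hmeas : ∀ i, Measurable (η i)) (hindep : iIndepFun η μ)
    (hident : ∀ i, Measure.map (η i) μ = Measure.map (η 0) μ)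
    (hint : Integrable (η 0) μ)
    (h0 : ∫ ω, η 0 ω ∂μ = 0) (n : ℕ) (x y lam : ℝ) (hy : 0 ≤ y) (hl : 0 ≤ lam)
    (H : Ω → ℝ) (hH : Integrable H μ)
    (hH0 : ∀ ω, 0 ≤ H ω)
    (hdom : ∀ ω, η 0 ω ≤ y → (η 0 ω) ^ 2 * Real.exp (max (lam * η 0 ω) 0) ≤ H ω) :
    (μ {ω | x < ∑ i ∈ Finset.range n, η i ω}).toReal ≤ n * (μ {ω | y < η 0 ω}).toReal +
      Real.exp (-lam * x + n * (lam ^ 2 * ∫ ω, H ω ∂μ)) := by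
  let φ : ℝ → ℝ := fun z => if z ≤ y then z else 0
  have hφ : Measurable φ := Measurable.ite measurableSet_Iic measurable_id measurable_const
  have hφy : ∀ z, φ z ≤ y := fun z => by simp only [φ]; split_ifs <;> assumption
  have hφz : ∀ z, φ z ≤ z := fun z => by simp only [φ]; split_ifs <;> linarith
  let ξ : ℕ → Ω → ℝ := fun i => φ ∘ η i
  have hξm : ∀ i, Measurable (ξ i) := fun i => hφ.comp (hmeas i)
  have hξi : iIndepFun ξ μ := hindep.comp (fun _ => φ) (fun _ => hφ)
  have hid : ∀ i, IdentDistrib (η i) (η 0) μ μ := fun i =>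
    ⟨(hmeas i).aemeasurable, (hmeas 0).aemeasurable, hident i⟩
  have hbd : ∀ (Z : Ω → ℝ) (B : ℝ), Measurable Z → (∀ ω, Z ω ≤ B) →
      Integrable (fun ω => Real.exp (lam * Z ω)) μ := by
    intro Z B hZ hB
    refine Integrable.of_bound (by fun_prop) (Real.exp (lam * B)) (Eventually.of_forall fun ω => ?_)
    rw [Real.norm_eq_abs, abs_of_pos (Real.exp_pos _)]
    have := hB ω
    gcongr
  have hmgf0 : mgf (ξ 0) μ lam ≤ Real.exp (lam ^ 2 * ∫ ω, H ω ∂μ) := by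
    have h1 : mgf (ξ 0) μ lam ≤ ∫ ω, (1 + lam * η 0 ω + lam ^ 2 * H ω) ∂μ := by
      refine integral_mono (hbd _ y (hξm 0) fun ω => hφy _)
        (((integrable_const _).add (hint.const_mul _)).add (hH.const_mul _)) fun ω => ?_
      show Real.exp (lam * φ (η 0 ω)) ≤ 1 + lam * η 0 ω + lam ^ 2 * H ω
      have h2 := aux_exp_s13 (lam * φ (η 0 ω))
      have h3 : lam * φ (η 0 ω) ≤ lam * η 0 ω := mul_le_mul_of_nonneg_left (hφz _) hl
      have h4 : (φ (η 0 ω)) ^ 2 * Real.exp (max (lam * φ (η 0 ω)) 0) ≤ H ω := by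
        by_cases h : η 0 ω ≤ y
        · simp only [φ, if_pos h]; exact hdom ω h
        · simp only [φ, if_neg h]; simpa using hH0 ω
      have h5 := mul_le_mul_of_nonneg_left h4 (sq_nonneg lam)
      rw [mul_pow] at h2
      linarith
    have h2 : ∫ ω, (1 + lam * η 0 ω + lam ^ 2 * H ω) ∂μ = lam ^ 2 * (∫ ω, H ω ∂μ) + 1 := by
      have hi : Integrable (fun ω => 1 + lam * η 0 ω) μ :=
        (integrable_const _).add (hint.const_mul _)
      rw [integral_add hi (hH.const_mul _),
        integral_add (integrable_const _) (hint.const_mul _), integral_const_mul,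
        integral_const_mul, h0]
      simp [add_comm]
    rw [h2] at h1
    exact h1.trans (Real.add_one_le_exp _)
  have hmgf : mgf (∑ i ∈ Finset.range n, ξ i) μ lam
      ≤ Real.exp (n * (lam ^ 2 * ∫ ω, H ω ∂μ)) := by
    rw [hξi.mgf_sum hξm, Real.exp_nat_mul]
    calc ∏ i ∈ Finset.range n, mgf (ξ i) μ lam
        ≤ ∏ i ∈ Finset.range n, Real.exp (lam ^ 2 * ∫ ω, H ω ∂μ) := by
          refine Finset.prod_le_prod (fun i _ => mgf_nonneg) fun i _ => ?_
          rw [mgf_congr_identDistrib ((hid i).comp hφ)]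
          exact hmgf0
      _ = _ := by simp
  have hch := measure_ge_le_exp_mul_mgf (μ := μ) (X := ∑ i ∈ Finset.range n, ξ i) (t := lam) x hl
    (hbd _ (n * y) (by fun_prop) fun ω => by
      rw [Finset.sum_apply]
      calc ∑ i ∈ Finset.range n, ξ i ω ≤ ∑ i ∈ Finset.range n, y :=
            Finset.sum_le_sum fun i _ => hφy _
        _ = n * y := by simp)
  have hsub : {ω | x < ∑ i ∈ Finset.range n, η i ω} ⊆
      (⋃ i ∈ Finset.range n, {ω | y < η i ω}) ∪ {ω | x ≤ (∑ i ∈ Finset.range n, ξ i) ω} := by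
    intro ω hω
    by_cases h : ∃ i ∈ Finset.range n, y < η i ω
    · left
      obtain ⟨i, hi, h⟩ := h
      exact Set.mem_biUnion hi h
    · right
      push Not at h
      have : ∑ i ∈ Finset.range n, ξ i ω = ∑ i ∈ Finset.range n, η i ω :=
        Finset.sum_congr rfl fun i hi => by simp only [ξ, φ, Function.comp, if_pos (h i hi)]
      show x ≤ (∑ i ∈ Finset.range n, ξ i) ω
      rw [Finset.sum_apply, this]
      exact le_of_lt hω
  have hun : μ.real (⋃ i ∈ Finset.range n, {ω | y < η i ω}) ≤ n * μ.real {ω | y < η 0 ω} := by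
    refine (measureReal_biUnion_finset_le _ _).trans ?_
    have : ∀ i, μ.real {ω | y < η i ω} = μ.real {ω | y < η 0 ω} := fun i => by
      unfold Measure.real
      congr 1
      exact (hid i).measure_mem_eq measurableSet_Ioi
    simp [this]
  have := (measureReal_mono hsub (μ := μ)).trans (measureReal_union_le _ _)
  rw [Real.exp_add]
  have h6 := mul_le_mul_of_nonneg_left hmgf (Real.exp_pos (-lam * x)).le
  change μ.real _ ≤ n * μ.real _ + _
  linarith

set_option maxHeartbeats 1600000

/-- For i.i.d. centred random variables with all moments
finite and hazard function `R` (`Ḡ(x) = e^{-R(x)}`) satisfying: for every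
`ε > 0` there is `x₀` with `R(x)/x ≤ (1+ε) R(z)/z` for all `x ≥ z ≥ x₀`,
then for every `ε ∈ (0,1)` there exists `c = c(ε) < ∞` such that
`ℙ(T_n > x) ≤ (n+1) Ḡ(y)` for all `x > 0`, `y ≤ (1-ε)x` and all `n` with
`n R(y)/x² ≤ 1/c`. -/
theorem sums_weibull_rough_upper
    {Ω : Type*} [MeasurableSpace Ω] (μ : Measure Ω) [IsProbabilityMeasure μ]
    (η : ℕ → Ω → ℝ)
    (hmeas : ∀ i, Measurable (η i))
    (hindep : iIndepFun η μ)
    (hident : ∀ i, Measure.map (η i) μ = Measure.map (η 0) μ)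
    (hint : Integrable (η 0) μ)
    (T : ℕ → Ω → ℝ) (hT : ∀ n ω, T n ω = ∑ i ∈ Finset.range n, η i ω)
    (Gbar : ℝ → ℝ) (hGbar : ∀ x, Gbar x = (μ {ω | x < η 0 ω}).toReal)
    -- zero mean
    (h0 : ∫ ω, η 0 ω ∂μ = 0)
    -- all moments finite
    (hmom : ∀ k : ℕ, Integrable (fun ω => |η 0 ω| ^ k) μ)
    -- hazard function
    (R : ℝ → ℝ) (hR : ∀ x, Gbar x = Real.exp (-R x))
    -- near-monotonicity of `R(x)/x`
    (hRmono : ∀ ε > (0 : ℝ), ∃ x₀ : ℝ, ∀ x z : ℝ, x₀ ≤ z → z ≤ x →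
      R x / x ≤ (1 + ε) * R z / z) :
    ∀ ε : ℝ, 0 < ε → ε < 1 → ∃ c > (0 : ℝ), ∀ x > (0 : ℝ), ∀ y ≤ (1 - ε) * x,
      ∀ n : ℕ, (n : ℝ) * R y / x ^ 2 ≤ 1 / c →
      (μ {ω | x < T n ω}).toReal ≤ (n + 1) * Gbar y := by
  intro ε hε hε1
  have hRn : ∀ x, 0 ≤ R x := by
    intro x
    have h1 : Gbar x ≤ 1 := by
      rw [hGbar]; exact measureReal_le_one
    rw [hR] at h1
    have := Real.exp_le_one_iff.1 h1
    linarith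
  have hGm : ∀ a b, a ≤ b → Gbar b ≤ Gbar a := by
    intro a b hab
    rw [hGbar, hGbar]
    refine ENNReal.toReal_mono (measure_ne_top _ _) (measure_mono fun ω hω => ?_)
    exact lt_of_le_of_lt hab hω
  have hsum : ∀ n x, (μ {ω | x < T n ω}) = μ {ω | x < ∑ i ∈ Finset.range n, η i ω} := by
    intro n x; simp only [hT]
  set s := ε ^ 2 with hs
  have hs0 : 0 < s := by positivity
  have hs1 : s < 1 := by rw [hs]; nlinarith
  obtain ⟨x₀, hx₀⟩ := hRmono (s / 4) (by positivity)
  obtain ⟨N, hN⟩ := exists_nat_ge (max x₀ (4 / s))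
  have hNx : x₀ ≤ N := (le_max_left _ _).trans hN
  have hNs : 4 ≤ s * N := by
    have := (le_max_right _ _).trans hN
    rw [div_le_iff₀ hs0] at this
    linarith
  have hN0 : (0 : ℝ) < N := by
    by_contra hh
    nlinarith
  have hR' : ∀ x, (μ {ω | x < η 0 ω}).toReal = Real.exp (-R x) := fun x => by rw [← hGbar, hR]
  have hD := aux_dom μ (η 0) (hmeas 0) hmom R hR' (s / 2) (by positivity)
  have h2i : Integrable (fun ω => (η 0 ω) ^ 2) μ := by simpa using hmom 2
  have h2 : MemLp (η 0) 2 μ := (memLp_two_iff_integrable_sq (hmeas 0).aestronglyMeasurable).2 h2i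
  set D : Ω → ℝ := fun ω => if 0 < η 0 ω then
      (η 0 ω) ^ 2 * Real.exp ((1 - s / 2) * R ((⌈η 0 ω⌉₊ - 1 : ℕ) : ℝ)) else 0 with hDdef
  have hD0 : ∀ ω, 0 ≤ D ω := fun ω => by simp only [hDdef]; split_ifs <;> positivity
  set H : Ω → ℝ := fun ω => (η 0 ω) ^ 2 * Real.exp (R N) + D ω with hHdef
  have hHi : Integrable H μ := (h2i.mul_const _).add hD
  have hH0 : ∀ ω, 0 ≤ H ω := fun ω => by have := hD0 ω; simp only [hHdef]; positivity
  set K := ∫ ω, H ω ∂μ with hK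
  have hK0 : 0 ≤ K := integral_nonneg hH0
  set V := variance (η 0) μ with hV
  have hV0 : 0 ≤ V := variance_nonneg _ _
  have hGN : 0 < Gbar N := by rw [hR]; positivity
  refine ⟨4 * K / ε + 2 * V / Gbar N + 1, by positivity, ?_⟩
  intro x hx y hy n hn
  set c := 4 * K / ε + 2 * V / Gbar N + 1 with hc
  have hc0 : 0 < c := by positivity
  have hcK : 4 * K ≤ c * ε := by
    have : 4 * K / ε ≤ c := by rw [hc]; have : 0 ≤ 2 * V / Gbar N := by positivity
                               linarith
    rwa [div_le_iff₀ hε] at this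
  have hcV : 2 * V ≤ c * Gbar N := by
    have : 2 * V / Gbar N ≤ c := by rw [hc]; have : 0 ≤ 4 * K / ε := by positivity
                                    linarith
    rwa [div_le_iff₀ hGN] at this
  have hn' : c * (n * R y) ≤ x ^ 2 := by
    rw [div_le_div_iff₀ (by positivity) hc0] at hn
    linarith
  have hGy : 0 < Gbar y := by rw [hR]; positivity
  rw [hsum]
  rcases Nat.eq_zero_or_pos n with rfl | hnpos
  · simp [hx.not_gt, hGy.le]
  have hn1 : (1 : ℝ) ≤ n := by exact_mod_cast hnpos
  by_cases hx2 : x ^ 2 * Gbar N < V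
  · -- small `x`
    have h1 : c * R y ≤ x ^ 2 := by
      have := hRn y
      refine le_trans ?_ hn'
      gcongr
      nlinarith
    have h3 : R y ≤ 1 / 2 := by
      by_contra hh
      push Not at hh
      have : c * (1 / 2) < x ^ 2 := lt_of_lt_of_le (by gcongr) h1
      nlinarith
    have h4 : 1 / 2 ≤ Gbar y := by
      rw [hR]; have := Real.add_one_le_exp (-R y); linarith
    calc (μ {ω | x < ∑ i ∈ Finset.range n, η i ω}).toReal ≤ 1 := measureReal_le_one
      _ ≤ (n + 1) * Gbar y := by nlinarith
  push Not at hx2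
  rcases le_or_gt y N with hyN | hyN
  · refine (aux_cheb μ η hmeas hindep hident h0 h2 n x hx).trans ?_
    rw [div_le_iff₀ (by positivity)]
    have h1 := hGm _ _ hyN
    have h3 : V ≤ x ^ 2 * Gbar y := hx2.trans (by gcongr)
    have : 0 ≤ x ^ 2 * Gbar y := by positivity
    nlinarith
  have hy0 : 0 < y := hN0.trans hyN
  set lam := (1 + ε) * R y / x with hlam
  have hlam0 : 0 ≤ lam := by have := hRn y; positivity
  have hlamy : lam ≤ (1 - s) * (R y / y) := by
    rw [hlam, ← mul_div_assoc, div_le_div_iff₀ hx hy0]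
    have := mul_le_mul_of_nonneg_left hy (mul_nonneg (by linarith : 0 ≤ 1 + ε) (hRn y))
    rw [hs]
    linarith
  have hdom : ∀ ω, η 0 ω ≤ y → (η 0 ω) ^ 2 * Real.exp (max (lam * η 0 ω) 0) ≤ H ω := by
    intro ω hω
    rcases le_or_gt (η 0 ω) N with h | h
    · have h3 := aux_lam s lam (R y) y (R N) N N hs0 hs1 hlamy (hx₀ y N hNx hyN.le) hN0
        (by linarith) hNs (hRn _)
      have h4 : max (lam * η 0 ω) 0 ≤ R N := by
        refine max_le ?_ (hRn _)
        have := mul_le_mul_of_nonneg_left h hlam0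
        nlinarith [hRn N]
      have := hD0 ω
      calc (η 0 ω) ^ 2 * Real.exp (max (lam * η 0 ω) 0) ≤ (η 0 ω) ^ 2 * Real.exp (R N) := by gcongr
        _ ≤ H ω := by simp only [hHdef]; linarith
    · have hpos : 0 < η 0 ω := hN0.trans h
      have hcl : N < ⌈η 0 ω⌉₊ := Nat.lt_ceil.2 h
      obtain ⟨m, hm⟩ : ∃ m, ⌈η 0 ω⌉₊ = m + 1 := ⟨⌈η 0 ω⌉₊ - 1, by omega⟩
      have h1 : (m : ℝ) < η 0 ω := Nat.lt_ceil.1 (by omega)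
      have h2 : η 0 ω ≤ m + 1 := by exact_mod_cast Nat.ceil_le.1 hm.le
      have hNm : (N : ℝ) ≤ m := by exact_mod_cast (by omega : N ≤ m)
      have h3 := aux_lam s lam (R y) y (R m) m (η 0 ω) hs0 hs1 hlamy
        (hx₀ y m (hNx.trans hNm) (h1.le.trans hω)) hpos h2
        (hNs.trans (by gcongr)) (hRn _)
      have hDv : D ω = (η 0 ω) ^ 2 * Real.exp ((1 - s / 2) * R m) := by
        simp only [hDdef, if_pos hpos, hm, Nat.add_sub_cancel]
      rw [max_eq_left (by positivity)]
      calc (η 0 ω) ^ 2 * Real.exp (lam * η 0 ω)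
          ≤ (η 0 ω) ^ 2 * Real.exp ((1 - s / 2) * R m) := by gcongr
        _ = D ω := hDv.symm
        _ ≤ H ω := by
          have : 0 ≤ (η 0 ω) ^ 2 * Real.exp (R N) := by positivity
          simp only [hHdef]; linarith
  refine (aux_chern μ η hmeas hindep hident hint h0 n x y lam hy0.le hlam0 H hHi hH0 hdom).trans ?_
  rw [← hGbar, add_mul, one_mul]
  gcongr
  rw [hR, Real.exp_le_exp, ← hK]
  have h7 : lam * x = (1 + ε) * R y := by rw [hlam]; field_simp
  have h8 : n * (lam ^ 2 * K) ≤ ε * R y := by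
    have e : n * (lam ^ 2 * K) = (1 + ε) ^ 2 * K * R y * (n * R y) / x ^ 2 := by
      rw [hlam]; field_simp
    rw [e, div_le_iff₀ (by positivity)]
    have hRy := hRn y
    calc (1 + ε) ^ 2 * K * R y * (n * R y) ≤ 4 * K * R y * (n * R y) := by
          gcongr; nlinarith
      _ ≤ c * ε * R y * (n * R y) := by gcongr
      _ = ε * R y * (c * (n * R y)) := by ring
      _ ≤ ε * R y * x ^ 2 := by gcongr
  linarith
end

section
/- Assume E(ξ log ξ) < ∞. Then, for every ε > 0, P{W_n > x} ≥ (1 + o(1))·Σ_{i=0}^{n-1} m^i·F̄(m^{i+1}(1+ε)x) as x → ∞, uniformly in n ≥ 1; that is, liminf_{x→∞} inf_{n≥1} P{W_n > x}/Σ_{i=0}^{n-1} m^i·F̄(m^{i+1}(1+ε)x) ≥ 1. -/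
open MeasureTheory Filter ProbabilityTheory

lemma gw_exp_bd {y : ℝ} (hy : 0 ≤ y) : Real.exp (-y) ≤ 1 - y + y * min 1 y := by
  rcases le_total y 1 with h | h
  · rw [min_eq_right h, Real.exp_neg]
    have h1 := Real.add_one_le_exp y
    have h2 : (Real.exp y)⁻¹ ≤ (y + 1)⁻¹ := inv_anti₀ (by linarith) h1
    refine h2.trans ?_
    rw [inv_le_iff_one_le_mul₀ (by linarith)]
    nlinarith [pow_nonneg hy 3]
  · rw [min_eq_left h]
    have : Real.exp (-y) ≤ 1 := Real.exp_le_one_iff.2 (by linarith)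
    linarith

/-- the constant -/
noncomputable def gwC (m : ℝ) : ℝ := (m + 1) / (m - 1)

lemma gw_log_step {m v : ℝ} (hm : 1 < m) (hv : 0 ≤ v) :
    gwC m * Real.log (1 + v) + min 1 v ≤ gwC m * Real.log (1 + m * v) := by
  have hm' : 0 < m - 1 := by linarith
  have hmv : 0 ≤ m * v := by positivity
  have h1 : 1 - (( 1 + m * v) / (1 + v))⁻¹ ≤ Real.log ((1 + m * v) / (1 + v)) :=
    Real.one_sub_inv_le_log_of_pos (by positivity)
  rw [Real.log_div (by positivity) (by positivity)] at h1
  have hC : 0 < gwC m := by unfold gwC; positivity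
  have h2 : min 1 v ≤ gwC m * (1 - (( 1 + m * v) / (1 + v))⁻¹) := by
    have e : gwC m * (1 - (( 1 + m * v) / (1 + v))⁻¹) = (m+1) * v / (1 + m * v) := by
      unfold gwC
      field_simp
      ring
    rw [e, le_div_iff₀ (by positivity)]
    rcases le_total v 1 with h | h
    · rw [min_eq_right h]; nlinarith [mul_nonneg hv (sub_nonneg.2 h)]
    · rw [min_eq_left h]; nlinarith
  nlinarith

lemma gw_int_log {Ω : Type*} [MeasurableSpace Ω] (μ : Measure Ω) 
    (X : Ω → ℕ) (hX : Measurable X) (hint : Integrable (fun ω => (X ω : ℝ)) μ)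
    (hlog : Integrable (fun ω => (X ω : ℝ) * Real.log (X ω : ℝ)) μ) {u : ℝ} (hu : 0 ≤ u) (hu1 : u ≤ 1) :
    (∀ ω, ‖(X ω : ℝ) * Real.log (1 + u * X ω)‖ ≤ X ω * Real.log 2 + (X ω : ℝ) * Real.log (X ω : ℝ)) ∧
    Integrable (fun ω => (X ω : ℝ) * Real.log (1 + u * X ω)) μ := by
  have hb : ∀ ω, ‖(X ω : ℝ) * Real.log (1 + u * X ω)‖ ≤ X ω * Real.log 2 + (X ω : ℝ) * Real.log (X ω : ℝ) := by
    intro ω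
    rcases Nat.eq_zero_or_pos (X ω) with h | h
    · simp [h]
    · have h1 : (1:ℝ) ≤ X ω := by exact_mod_cast h
      have h0 : 0 ≤ Real.log (1 + u * X ω) := Real.log_nonneg (by nlinarith)
      rw [Real.norm_of_nonneg (by positivity), ← mul_add, ← Real.log_mul (by norm_num) (by positivity)]
      gcongr
      nlinarith
  refine ⟨hb, ?_⟩
  have hm : Measurable fun ω => (X ω : ℝ) := measurable_from_top.comp hX
  refine Integrable.mono' ((hint.mul_const (Real.log 2)).add hlog) ?_ (ae_of_all _ hb)
  exact (hm.mul (Real.measurable_log.comp (by fun_prop))).aestronglyMeasurable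

lemma gw_phi {Ω : Type*} [MeasurableSpace Ω] (μ : Measure Ω) [IsProbabilityMeasure μ]
    (X : Ω → ℕ) (hX : Measurable X) (hint : Integrable (fun ω => (X ω : ℝ)) μ)
    (hlog : Integrable (fun ω => (X ω : ℝ) * Real.log (X ω : ℝ)) μ) 
    (m : ℝ) (hm : m = ∫ ω, (X ω : ℝ) ∂μ) (hm1 : 1 < m) (δ : ℝ) (hδ : 0 < δ) :
    ∃ v : ℝ, 0 < v ∧ v ≤ 1 ∧ ∀ l : ℕ, 
      (fun s : ℝ => ∫ ω, s ^ X ω ∂μ)^[l] (Real.exp (-v / m ^ l)) ≤ 1 - (1 - δ) * v := by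
  have hXm : Measurable fun ω => (X ω : ℝ) := measurable_from_top.comp hX
  set f : ℝ → ℝ := fun s : ℝ => ∫ ω, s ^ X ω ∂μ with hf
  set C := gwC m with hCdef
  have hC : 0 < C := by rw [hCdef]; unfold gwC; exact div_pos (by linarith) (by linarith)
  set H : ℝ → ℝ := fun u => ∫ ω, (X ω : ℝ) * Real.log (1 + u * X ω) ∂μ with hH
  have hpi : ∀ s : ℝ, 0 ≤ s → s ≤ 1 → Integrable (fun ω => s ^ X ω) μ := by
    intro s h0 h1
    refine Integrable.mono' (integrable_const (1:ℝ)) ?_ (ae_of_all _ fun ω => ?_)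
    · exact ((measurable_from_top (f := fun k : ℕ => s ^ k)).comp hX).aestronglyMeasurable
    · rw [Real.norm_of_nonneg (by positivity)]; exact pow_le_one₀ h0 h1
  have hmini : ∀ v : ℝ, 0 ≤ v → Integrable (fun ω => (X ω : ℝ) * min 1 (v * X ω)) μ := by
    intro v hv
    refine Integrable.mono' hint (by fun_prop) (ae_of_all _ fun ω => ?_)
    rw [Real.norm_of_nonneg (by positivity)]
    exact mul_le_of_le_one_right (by positivity) (min_le_left _ _)
  -- main induction
  have main : ∀ l : ℕ, ∀ u : ℝ, 0 < u → u ≤ 1 →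
      0 ≤ f^[l] (Real.exp (-u / m ^ l)) ∧ f^[l] (Real.exp (-u / m ^ l)) ≤ 1 ∧
      1 - u ≤ f^[l] (Real.exp (-u / m ^ l)) ∧
      f^[l] (Real.exp (-u / m ^ l)) ≤ 1 - u + u * (u + C / m * H u) := by
    intro l
    induction l with
    | zero =>
      intro u hu hu1
      have hH0 : 0 ≤ H u := integral_nonneg fun ω => mul_nonneg (by positivity)
          (Real.log_nonneg (by nlinarith [(Nat.cast_nonneg (X ω) : (0:ℝ) ≤ _)]))
      have h1 := gw_exp_bd hu.le
      rw [min_eq_right hu1] at h1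
      have h2 := Real.add_one_le_exp (-u)
      have h3 : 0 ≤ u * (C / m * H u) := by positivity
      simp only [pow_zero, div_one, Function.iterate_zero, id_eq]
      refine ⟨(Real.exp_pos _).le, Real.exp_le_one_iff.2 (by linarith), by linarith, by nlinarith⟩
    | succ l ih =>
      intro u hu hu1
      have hm0 : 0 < m := by linarith
      set v := u / m with hv
      have hv0 : 0 < v := by positivity
      have huv : u = m * v := by rw [hv]; field_simp
      have hvu : v ≤ u := div_le_self hu.le hm1.le
      obtain ⟨h0, h1, h2, h3⟩ := ih v hv0 (hvu.trans hu1)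
      have e : -u / m ^ (l+1) = -v / m ^ l := by rw [hv, pow_succ]; field_simp
      rw [e, Function.iterate_succ_apply']
      set s := f^[l] (Real.exp (-v / m ^ l)) with hs
      have hlow : 1 - m * (1 - s) ≤ f s := by
        have : ∫ ω, (1 - X ω * (1 - s)) ∂μ ≤ f s := by
          refine integral_mono ((integrable_const _).sub (hint.mul_const _)) (hpi s h0 h1) fun ω => ?_
          have := one_add_mul_le_pow (a := s - 1) (by linarith) (X ω)
          simp only [add_sub_cancel] at this
          simp only
          linarith
        rw [integral_sub (integrable_const _) (hint.mul_const _), integral_mul_const, ← hm] at this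
        simpa using this
      have hup : f s ≤ 1 - m * (1 - s) + v * ∫ ω, (X ω : ℝ) * min 1 (v * X ω) ∂μ := by
        have : f s ≤ ∫ ω, ((1 - X ω * (1 - s)) + v * ((X ω : ℝ) * min 1 (v * X ω))) ∂μ := by
          refine integral_mono (hpi s h0 h1) (((integrable_const _).sub (hint.mul_const _)).add ((hmini v hv0.le).const_mul _)) fun ω => ?_
          simp only
          have hs' : s ≤ Real.exp (-(1 - s)) := by
            have := Real.add_one_le_exp (-(1-s)); linarith
          have a1 : s ^ X ω ≤ Real.exp (-((1 - s) * X ω)) := by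
            calc s ^ X ω ≤ Real.exp (-(1-s)) ^ X ω := pow_le_pow_left₀ h0 hs' _
              _ = _ := by rw [← Real.exp_nat_mul]; ring_nf
          have a2 := gw_exp_bd (y := (1 - s) * X ω) (mul_nonneg (by linarith) (by positivity))
          have a3 : (1 - s) * X ω * min 1 ((1 - s) * X ω) ≤ v * X ω * min 1 (v * X ω) := by
            have : 1 - s ≤ v := by linarith
            have h5 : 0 ≤ 1 - s := by linarith
            gcongr
          linarith
        have iA : Integrable (fun ω => 1 - (X ω : ℝ) * (1 - s)) μ := (integrable_const _).sub (hint.mul_const _)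
        rw [integral_add iA ((hmini v hv0.le).const_mul _),
          integral_sub (integrable_const _) (hint.mul_const _), integral_mul_const, integral_const_mul, ← hm] at this
        simpa using this
      have hHs : C * H v + ∫ ω, (X ω : ℝ) * min 1 (v * X ω) ∂μ ≤ C * H u := by
        have i1 := (gw_int_log μ X hX hint hlog hv0.le (hvu.trans hu1)).2
        have i2 := (gw_int_log μ X hX hint hlog hu.le hu1).2
        rw [hH]
        simp only
        rw [← integral_const_mul, ← integral_const_mul, ← integral_add (i1.const_mul _) (hmini v hv0.le)]
        refine integral_mono ((i1.const_mul _).add (hmini v hv0.le)) (i2.const_mul _) fun ω => ?_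
        have := gw_log_step (v := v * X ω) hm1 (by positivity)
        rw [← mul_assoc, ← huv] at this
        have h5 : (0:ℝ) ≤ X ω := by positivity
        simp only
        nlinarith
      refine ⟨integral_nonneg fun ω => pow_nonneg h0 _, ?_, by nlinarith, ?_⟩
      · have : f s ≤ ∫ ω, (1:ℝ) ∂μ := integral_mono (hpi s h0 h1) (integrable_const _) fun ω => pow_le_one₀ h0 h1
        simpa using this
      · have h6 : m * (1 - s) ≥ u - u * (v + C / m * H v) := by rw [huv]; nlinarith
        have h7 : v * ∫ ω, (X ω : ℝ) * min 1 (v * X ω) ∂μ ≤ u * (C / m * H u - C / m * H v) := by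
          have : u * (C / m * H u - C / m * H v) = v * (C * H u - C * H v) := by rw [huv]; field_simp
          rw [this]
          gcongr
          linarith
        nlinarith
  -- H → 0
  have hlim : Tendsto (fun k : ℕ => H (1 / ((k:ℝ) + 1))) atTop (nhds 0) := by
    have h0 : (0:ℝ) = ∫ ω, (0:ℝ) ∂μ := by simp
    rw [h0]
    have hk : ∀ k : ℕ, 0 ≤ 1 / ((k:ℝ) + 1) ∧ 1 / ((k:ℝ)+1) ≤ 1 := fun k =>
      ⟨by positivity, by rw [div_le_one (by positivity)]; linarith [(Nat.cast_nonneg k : (0:ℝ) ≤ k)]⟩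
    refine tendsto_integral_of_dominated_convergence
      (fun ω => X ω * Real.log 2 + (X ω : ℝ) * Real.log (X ω : ℝ)) (fun k => ?_) ((hint.mul_const _).add hlog)
      (fun k => ae_of_all _ ?_) (ae_of_all _ fun ω => ?_)
    · exact (gw_int_log μ X hX hint hlog (hk k).1 (hk k).2).2.aestronglyMeasurable
    · exact (gw_int_log μ X hX hint hlog (hk k).1 (hk k).2).1
    · have t1 : Tendsto (fun k : ℕ => 1 + 1 / ((k:ℝ) + 1) * X ω) atTop (nhds 1) := by
        simpa using (tendsto_one_div_add_atTop_nhds_zero_nat.mul_const (X ω : ℝ)).const_add 1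
      have := (t1.log one_ne_zero).const_mul (X ω : ℝ)
      simpa using this
  have hlim2 : Tendsto (fun k : ℕ => 1 / ((k:ℝ) + 1) + C / m * H (1 / ((k:ℝ) + 1))) atTop (nhds 0) := by
    simpa using (tendsto_one_div_add_atTop_nhds_zero_nat (𝕜 := ℝ)).add (hlim.const_mul (C / m))
  obtain ⟨k, hk⟩ := (hlim2.eventually (gt_mem_nhds hδ)).exists
  have hk0 : (0:ℝ) < 1 / ((k:ℝ) + 1) := by positivity
  have hk1 : 1 / ((k:ℝ)+1) ≤ 1 := by rw [div_le_one (by positivity)]; linarith [(Nat.cast_nonneg k : (0:ℝ) ≤ k)]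
  refine ⟨_, hk0, hk1, fun l => ?_⟩
  have := (main l _ hk0 hk1).2.2.2
  nlinarith

/-- The sigma-algebra of the first n generations. -/
@[reducible] def gwF {Ω : Type*} (ξ : ℕ → ℕ → Ω → ℕ) (n : ℕ) : MeasurableSpace Ω :=
  ⨆ p ∈ {p : ℕ × ℕ | p.1 < n}, MeasurableSpace.comap (ξ p.1 p.2) ⊤

lemma gwF_le {Ω : Type*} [mΩ : MeasurableSpace Ω] (ξ : ℕ → ℕ → Ω → ℕ)
    (hmeas : ∀ n i, Measurable (ξ n i)) (n : ℕ) : gwF ξ n ≤ mΩ :=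
  iSup₂_le fun p _ => (hmeas p.1 p.2).comap_le

lemma gwF_mono {Ω : Type*} (ξ : ℕ → ℕ → Ω → ℕ) {n k : ℕ} (h : n ≤ k) : gwF ξ n ≤ gwF ξ k :=
  iSup₂_le fun p hp => le_iSup₂_of_le (f := fun (p : ℕ × ℕ) (_ : p ∈ {p : ℕ × ℕ | p.1 < k}) =>
    MeasurableSpace.comap (ξ p.1 p.2) ⊤) p (lt_of_lt_of_le hp h) le_rfl

lemma gwF_xi {Ω : Type*} (ξ : ℕ → ℕ → Ω → ℕ) {n k : ℕ} (h : n < k) (i : ℕ) :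
    Measurable[gwF ξ k] (ξ n i) := by
  rw [measurable_iff_comap_le]
  exact le_iSup₂_of_le (f := fun (p : ℕ × ℕ) (_ : p ∈ {p : ℕ × ℕ | p.1 < k}) =>
    MeasurableSpace.comap (ξ p.1 p.2) ⊤) (n, i) h le_rfl

lemma gwF_Z {Ω : Type*} (ξ : ℕ → ℕ → Ω → ℕ) (Z : ℕ → Ω → ℕ)
    (hZ0 : ∀ ω, Z 0 ω = 1)
    (hZrec : ∀ n ω, Z (n + 1) ω = ∑ i ∈ Finset.range (Z n ω), ξ n i ω) (n : ℕ) :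
    Measurable[gwF ξ n] (Z n) := by
  induction n with
  | zero =>
    have : Z 0 = fun _ => 1 := funext hZ0
    rw [this]; exact measurable_const
  | succ n ih =>
    let _ := gwF ξ (n+1)
    have h1 : Measurable (Z n) := ih.mono (gwF_mono ξ n.le_succ) le_rfl
    have h2 : ∀ k, Measurable (fun ω => ∑ i ∈ Finset.range k, ξ n i ω) := fun k =>
      Finset.measurable_sum _ fun i _ => gwF_xi ξ n.lt_succ_self i
    have h3 : Measurable (fun q : Ω × ℕ => ∑ i ∈ Finset.range q.2, ξ n i q.1) :=
      measurable_from_prod_countable_left h2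
    have : Z (n+1) = (fun q : Ω × ℕ => ∑ i ∈ Finset.range q.2, ξ n i q.1) ∘ fun ω => (ω, Z n ω) :=
      funext (hZrec n)
    rw [this]
    exact h3.comp (measurable_id.prodMk h1)

lemma gw_prod_indep {Ω : Type*} [MeasurableSpace Ω] (μ : Measure Ω) [IsProbabilityMeasure μ]
    (ξ : ℕ → ℕ → Ω → ℕ)
    (hmeas : ∀ n i, Measurable (ξ n i))
    (hindep : iIndepFun
      (fun p : ℕ × ℕ => ξ p.1 p.2) μ)
    (hident : ∀ n i, Measure.map (ξ n i) μ = Measure.map (ξ 0 0) μ)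
    (n k : ℕ) (A : Set Ω) (hA : MeasurableSet[gwF ξ n] A) (h : ℕ → ℝ) :
    ∫ ω in A, ∏ j ∈ Finset.range k, h (ξ n j ω) ∂μ = μ.real A * (∫ ω, h (ξ 0 0 ω) ∂μ) ^ k := by
  have hind : Indep (gwF ξ n) (⨆ p ∈ {p : ℕ × ℕ | p.1 = n}, MeasurableSpace.comap (ξ p.1 p.2) ⊤) μ := by
    refine indep_iSup_of_disjoint (m := fun p : ℕ × ℕ => MeasurableSpace.comap (ξ p.1 p.2) ⊤)
      (fun p => (hmeas p.1 p.2).comap_le) hindep.iIndep ?_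
    rw [Set.disjoint_left]
    intro p hp hp'
    simp only [Set.mem_ofPred_eq] at hp hp'
    omega
  let X : Ω → (Fin k → ℕ) := fun ω j => ξ n j ω
  have hX : Measurable X := measurable_pi_lambda _ fun j => hmeas n j
  have hind2 : Indep (gwF ξ n) (MeasurableSpace.comap X inferInstance) μ := by
    refine indep_of_indep_of_le_right hind ?_
    rw [← measurable_iff_comap_le]
    refine @measurable_pi_lambda _ _ _ (⨆ p ∈ {p : ℕ × ℕ | p.1 = n}, MeasurableSpace.comap (ξ p.1 p.2) ⊤) _ _ fun j => ?_
    rw [measurable_iff_comap_le]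
    exact le_iSup₂_of_le (f := fun (p : ℕ × ℕ) (_ : p ∈ {p : ℕ × ℕ | p.1 = n}) =>
      MeasurableSpace.comap (ξ p.1 p.2) ⊤) (n, (j:ℕ)) rfl le_rfl
  have key := hind2.setIntegral_eq_mul (gwF_le ξ hmeas n) hX.aemeasurable hA
    (f := fun x => ∏ j, h (x j)) (Measurable.of_discrete.aestronglyMeasurable)
  have hiX : iIndepFun (fun (j : Fin k) => ξ n j) μ :=
    hindep.precomp (g := fun j : Fin k => (n, (j:ℕ))) (fun a b hab => by
      simp only [Prod.mk.injEq, true_and] at hab; exact Fin.ext hab)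
  have h2 := hiX.integral_fun_prod_comp (f := fun _ => h) (fun j => (hmeas n j).aemeasurable)
    (fun j => Measurable.of_discrete.aestronglyMeasurable)
  have h3 : ∀ j : Fin k, ∫ ω, h (ξ n j ω) ∂μ = ∫ ω, h (ξ 0 0 ω) ∂μ := by
    intro j
    rw [← integral_map (hmeas n j).aemeasurable (Measurable.of_discrete.aestronglyMeasurable), hident,
      integral_map (hmeas 0 0).aemeasurable (Measurable.of_discrete.aestronglyMeasurable)]
  simp only [X] at key
  rw [h2] at key
  simp only [h3, Finset.prod_const, Finset.card_univ, Fintype.card_fin] at key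
  rw [← key]
  simp only [Finset.prod_range]

lemma gw_key {Ω : Type*} [MeasurableSpace Ω] (μ : Measure Ω) [IsProbabilityMeasure μ]
    (ξ : ℕ → ℕ → Ω → ℕ)
    (hmeas : ∀ n i, Measurable (ξ n i))
    (hindep : iIndepFun
      (fun p : ℕ × ℕ => ξ p.1 p.2) μ)
    (hident : ∀ n i, Measure.map (ξ n i) μ = Measure.map (ξ 0 0) μ)
    (N : Ω → ℕ) (n : ℕ) (hN : Measurable[gwF ξ n] N)
    (A : Set Ω) (hA : MeasurableSet[gwF ξ n] A) (h : ℕ → ℝ)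
    (h0 : ∀ k, 0 ≤ h k) (h1 : ∀ k, h k ≤ 1) :
    ∫ ω in A, ∏ j ∈ Finset.range (N ω), h (ξ n j ω) ∂μ =
      ∫ ω in A, (∫ ω, h (ξ 0 0 ω) ∂μ) ^ N ω ∂μ := by
  set c := ∫ ω, h (ξ 0 0 ω) ∂μ with hc
  have hhm : Measurable h := Measurable.of_discrete
  have hci : Integrable (fun ω => h (ξ 0 0 ω)) μ := 
    Integrable.mono' (integrable_const (1:ℝ)) (hhm.comp (hmeas 0 0)).aestronglyMeasurable
      (ae_of_all _ fun ω => by rw [Real.norm_of_nonneg (h0 _)]; exact h1 _)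
  have hc0 : 0 ≤ c := integral_nonneg fun ω => h0 _
  have hc1 : c ≤ 1 := by
    have : c ≤ ∫ ω, (1:ℝ) ∂μ := integral_mono hci (integrable_const _) fun ω => h1 _
    simpa using this
  have hle := gwF_le ξ hmeas n
  have hN' : Measurable N := hN.mono hle le_rfl
  have hs : ∀ k, MeasurableSet[gwF ξ n] (A ∩ N ⁻¹' {k}) := fun k => 
    MeasurableSet.inter hA (hN (measurableSet_singleton k))
  have hU : A = ⋃ k, A ∩ N ⁻¹' {k} := by
    ext ω; simp
  have hd : Pairwise (Function.onFun Disjoint fun k => A ∩ N ⁻¹' {k}) := by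
    intro a b hab
    rw [Function.onFun, Set.disjoint_left]
    rintro ω ⟨_, h1⟩ ⟨_, h2⟩
    simp only [Set.mem_preimage, Set.mem_singleton_iff] at h1 h2
    exact hab (h1.symm.trans h2)
  have hm1 : Measurable (fun ω => ∏ j ∈ Finset.range (N ω), h (ξ n j ω)) := by
    have h3 : Measurable (fun q : Ω × ℕ => ∏ i ∈ Finset.range q.2, h (ξ n i q.1)) :=
      measurable_from_prod_countable_left fun k => by
        have : ∀ i, Measurable fun ω => h (ξ n i ω) := fun i => hhm.comp (hmeas n i)
        simp only
        exact Finset.measurable_prod _ fun i _ => this i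
    exact h3.comp (measurable_id.prodMk hN')
  have i1 : Integrable (fun ω => ∏ j ∈ Finset.range (N ω), h (ξ n j ω)) μ := 
    Integrable.mono' (integrable_const (1:ℝ)) hm1.aestronglyMeasurable
      (ae_of_all _ fun ω => by
        rw [Real.norm_of_nonneg (Finset.prod_nonneg fun _ _ => h0 _)]
        exact Finset.prod_le_one (fun _ _ => h0 _) fun _ _ => h1 _)
  have i2 : Integrable (fun ω => c ^ N ω) μ := 
    Integrable.mono' (integrable_const (1:ℝ)) 
      ((measurable_from_top (f := fun k : ℕ => c ^ k)).comp hN').aestronglyMeasurable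
      (ae_of_all _ fun ω => by
        rw [Real.norm_of_nonneg (by positivity)]
        exact pow_le_one₀ hc0 hc1)
  rw [hU, integral_iUnion (fun k => hle _ (hs k)) hd i1.integrableOn, 
    integral_iUnion (fun k => hle _ (hs k)) hd i2.integrableOn]
  congr 1
  ext k
  have e1 : ∫ ω in A ∩ N ⁻¹' {k}, ∏ j ∈ Finset.range (N ω), h (ξ n j ω) ∂μ = 
      ∫ ω in A ∩ N ⁻¹' {k}, ∏ j ∈ Finset.range k, h (ξ n j ω) ∂μ := 
    setIntegral_congr_fun (hle _ (hs k)) fun ω hω => by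
      have : N ω = k := hω.2
      simp only [this]
  have e2 : ∫ ω in A ∩ N ⁻¹' {k}, c ^ N ω ∂μ = ∫ ω in A ∩ N ⁻¹' {k}, c ^ k ∂μ := 
    setIntegral_congr_fun (hle _ (hs k)) fun ω hω => by
      have : N ω = k := hω.2
      simp only [this]
  rw [e1, e2, gw_prod_indep μ ξ hmeas hindep hident n k _ (hs k) h, setIntegral_const, smul_eq_mul]

lemma gw_iter {Ω : Type*} [MeasurableSpace Ω] (μ : Measure Ω) [IsProbabilityMeasure μ]
    (ξ : ℕ → ℕ → Ω → ℕ)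
    (hmeas : ∀ n i, Measurable (ξ n i))
    (hindep : iIndepFun
      (fun p : ℕ × ℕ => ξ p.1 p.2) μ)
    (hident : ∀ n i, Measure.map (ξ n i) μ = Measure.map (ξ 0 0) μ)
    (Z : ℕ → Ω → ℕ)
    (hZ0 : ∀ ω, Z 0 ω = 1)
    (hZrec : ∀ n ω, Z (n + 1) ω = ∑ i ∈ Finset.range (Z n ω), ξ n i ω)
    (k : ℕ) (A : Set Ω) (hA : MeasurableSet[gwF ξ k] A) (l : ℕ) :
    ∀ s : ℝ, 0 ≤ s → s ≤ 1 → ∫ ω in A, s ^ Z (k + l) ω ∂μ =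
      ∫ ω in A, ((fun s : ℝ => ∫ ω, s ^ ξ 0 0 ω ∂μ)^[l] s) ^ Z k ω ∂μ := by
  induction l with
  | zero => intro s _ _; simp
  | succ l ih =>
    intro s hs0 hs1
    have hI : Integrable (fun ω => s ^ ξ 0 0 ω) μ := 
      Integrable.mono' (integrable_const (1:ℝ)) 
        ((measurable_from_top (f := fun k : ℕ => s ^ k)).comp (hmeas 0 0)).aestronglyMeasurable
        (ae_of_all _ fun ω => by
          rw [Real.norm_of_nonneg (by positivity)]
          exact pow_le_one₀ hs0 hs1)
    have hc0 : 0 ≤ ∫ ω, s ^ ξ 0 0 ω ∂μ := integral_nonneg fun ω => pow_nonneg hs0 _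
    have hc1 : ∫ ω, s ^ ξ 0 0 ω ∂μ ≤ 1 := by
      have : ∫ ω, s ^ ξ 0 0 ω ∂μ ≤ ∫ ω, (1:ℝ) ∂μ := 
        integral_mono hI (integrable_const _) fun ω => pow_le_one₀ hs0 hs1
      simpa using this
    rw [Function.iterate_succ_apply, ← ih _ hc0 hc1]
    have := gw_key μ ξ hmeas hindep hident (Z (k + l)) (k + l) (gwF_Z ξ Z hZ0 hZrec _) A
      (gwF_mono ξ (Nat.le_add_right k l) _ hA) (fun j => s ^ j) (fun j => pow_nonneg hs0 j) 
      (fun j => pow_le_one₀ hs0 hs1)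
    rw [← this]
    simp only [← add_assoc, hZrec, Finset.prod_pow_eq_pow_sum]

lemma gw_sum_ind {m : ℝ} (hm : 1 < m) (z y : ℝ) (hz : 0 ≤ z) (hy : 0 < y) (n : ℕ) :
    ∑ i ∈ Finset.range n, m ^ i * (if m ^ (i + 1) * y < z then (1:ℝ) else 0) ≤ z / ((m - 1) * y) := by
  have hm' : 0 < m - 1 := by linarith
  induction n with
  | zero => simp; positivity
  | succ n ih =>
    by_cases h : m ^ (n + 1) * y < z
    · calc ∑ i ∈ Finset.range (n+1), m ^ i * (if m ^ (i + 1) * y < z then (1:ℝ) else 0) 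
          ≤ ∑ i ∈ Finset.range (n+1), m ^ i := by
            refine Finset.sum_le_sum fun i _ => ?_
            have : 0 ≤ m ^ i := by positivity
            split_ifs <;> linarith
        _ = (m ^ (n+1) - 1) / (m - 1) := geom_sum_eq hm.ne' _
        _ ≤ z / ((m - 1) * y) := by
            rw [div_le_div_iff₀ hm' (by positivity)]
            have : (m ^ (n+1) - 1) * y ≤ z := by linarith [sub_mul (m ^ (n+1)) 1 y]
            calc (m ^ (n+1) - 1) * ((m - 1) * y) = ((m ^ (n+1) - 1) * y) * (m - 1) := by ring
              _ ≤ _ := by gcongr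
    · rw [Finset.sum_range_succ, if_neg h]; linarith

lemma gw_S_bound {Ω : Type*} [MeasurableSpace Ω] (μ : Measure Ω) [IsProbabilityMeasure μ]
    (X : Ω → ℕ) (hX : Measurable X) (hint : Integrable (fun ω => (X ω : ℝ)) μ)
    {m : ℝ} (hm : m = ∫ ω, (X ω : ℝ) ∂μ) (hm1 : 1 < m) (y : ℝ) (hy : 0 < y) (n : ℕ) :
    ∑ i ∈ Finset.range n, m ^ i * μ.real {ω | m ^ (i + 1) * y < (X ω : ℝ)} ≤ m / ((m - 1) * y) := by
  have hXm : Measurable fun ω => (X ω : ℝ) := measurable_from_top.comp hX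
  have hms : ∀ a : ℝ, MeasurableSet {ω | a < (X ω : ℝ)} := fun a => measurableSet_lt measurable_const hXm
  have e : ∀ i, m ^ i * μ.real {ω | m ^ (i + 1) * y < (X ω : ℝ)} = 
      ∫ ω, m ^ i * (if m ^ (i + 1) * y < (X ω:ℝ) then (1:ℝ) else 0) ∂μ := by
    intro i
    rw [integral_const_mul, ← integral_indicator_one (hms _)]
    rfl
  have hi : ∀ i, Integrable (fun ω => m ^ i * (if m ^ (i + 1) * y < (X ω:ℝ) then (1:ℝ) else 0)) μ := by
    intro i
    refine Integrable.const_mul ?_ _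
    exact (integrable_const (1:ℝ)).indicator (hms (m ^ (i+1) * y))
  rw [Finset.sum_congr rfl fun i _ => e i, ← integral_finsetSum _ fun i _ => hi i]
  calc _ ≤ ∫ ω, (X ω : ℝ) / ((m - 1) * y) ∂μ := 
        integral_mono (integrable_finsetSum _ fun i _ => hi i) (hint.div_const _) fun ω => 
          gw_sum_ind hm1 _ _ (by positivity) hy n
    _ = _ := by rw [integral_div, ← hm]

lemma gw_conc {θ y : ℝ} (h0 : 0 ≤ θ) (h1 : θ ≤ 1) :
    θ * (1 - Real.exp (-y)) ≤ 1 - Real.exp (-(θ * y)) := by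
  have := convexOn_exp.2 (Set.mem_univ (-y)) (Set.mem_univ 0) h0 (sub_nonneg.2 h1) (by ring)
  simp only [smul_eq_mul, mul_zero, add_zero, Real.exp_zero, mul_one] at this
  rw [mul_neg] at this
  linarith

lemma gw_D {Ω : Type*} [MeasurableSpace Ω] (μ : Measure Ω) [IsProbabilityMeasure μ]
    (N : Ω → ℕ) (hN : Measurable N) (A : Set Ω) (hA : MeasurableSet A)
    (M v p δ : ℝ) (hM : 0 < M) (hv : 0 < v) (hp0 : 0 ≤ p) (hp1 : p ≤ 1) (hpv : M * p ≤ v)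
    (hAc : μ.real Aᶜ ≤ δ * v)
    (hphi : ∫ ω, Real.exp (-v / M) ^ N ω ∂μ ≤ 1 - (1 - δ) * v) :
    (1 - 2 * δ) * (M * p) ≤ μ.real A - ∫ ω in A, (1 - p) ^ N ω ∂μ := by
  have hI : ∀ s : ℝ, 0 ≤ s → s ≤ 1 → Integrable (fun ω => s ^ N ω) μ := fun s hs0 hs1 =>
      Integrable.mono' (integrable_const (1:ℝ)) 
        ((measurable_from_top (f := fun k : ℕ => s ^ k)).comp hN).aestronglyMeasurable
        (ae_of_all _ fun ω => by
          rw [Real.norm_of_nonneg (by positivity)]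
          exact pow_le_one₀ hs0 hs1)
  set s := Real.exp (-v / M) with hs
  have hs0 : 0 ≤ s := (Real.exp_pos _).le
  have hs1 : s ≤ 1 := Real.exp_le_one_iff.2 (by rw [neg_div]; have := div_pos hv hM; linarith)
  have iS := hI s hs0 hs1
  have iP := hI (1 - p) (by linarith) (by linarith)
  have i1 : Integrable (fun _ : Ω => (1:ℝ)) μ := integrable_const _
  have e1 : μ.real A - ∫ ω in A, (1 - p) ^ N ω ∂μ = ∫ ω in A, (1 - (1 - p) ^ N ω) ∂μ := by
    rw [integral_sub i1.integrableOn iP.integrableOn]; simp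
  have e2 : ∫ ω in A, (1 - s ^ N ω) ∂μ + ∫ ω in Aᶜ, (1 - s ^ N ω) ∂μ = ∫ ω, (1 - s ^ N ω) ∂μ :=
    integral_add_compl hA (i1.sub iS)
  have e3 : ∫ ω, (1 - s ^ N ω) ∂μ ≥ (1 - δ) * v := by
    rw [integral_sub i1 iS]; simp; linarith
  have e4 : ∫ ω in Aᶜ, (1 - s ^ N ω) ∂μ ≤ δ * v := by
    refine le_trans ?_ hAc
    have : ∫ ω in Aᶜ, (1 - s ^ N ω) ∂μ ≤ ∫ ω in Aᶜ, (1:ℝ) ∂μ := 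
      integral_mono (i1.sub iS).integrableOn i1.integrableOn fun ω => by
        have := pow_nonneg hs0 (N ω)
        simp only; linarith
    simpa using this
  have e5 : M * p / v * ∫ ω in A, (1 - s ^ N ω) ∂μ ≤ ∫ ω in A, (1 - (1 - p) ^ N ω) ∂μ := by
    rw [← integral_const_mul]
    refine integral_mono ((i1.sub iS).integrableOn.const_mul _) (i1.sub iP).integrableOn fun ω => ?_
    simp only
    have c1 := gw_conc (θ := M * p / v) (y := v / M * N ω) (by positivity) ((div_le_one hv).2 hpv)
    have c2 : s ^ N ω = Real.exp (-(v / M * N ω)) := by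
      rw [hs, ← Real.exp_nat_mul]; ring_nf
    have c3 : M * p / v * (v / M * N ω) = p * N ω := by field_simp
    have c4 : (1 - p) ^ N ω ≤ Real.exp (-(p * N ω)) := by
      calc (1 - p) ^ N ω ≤ Real.exp (-p) ^ N ω := 
            pow_le_pow_left₀ (by linarith) (by have := Real.add_one_le_exp (-p); linarith) _
        _ = _ := by rw [← Real.exp_nat_mul]; ring_nf
    rw [c3] at c1
    rw [c2]
    linarith
  rw [e1]
  refine le_trans ?_ e5
  calc (1 - 2 * δ) * (M * p) = M * p / v * ((1 - 2 * δ) * v) := by field_simp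
    _ ≤ _ := by
      gcongr
      linarith

/-- no large family before generation i -/
def gwNo {Ω : Type*} (ξ : ℕ → ℕ → Ω → ℕ) (Z : ℕ → Ω → ℕ) (thr : ℕ → ℝ) (i : ℕ) : Set Ω :=
  {ω | ∀ k, k < i → ∀ j, j < Z k ω → (ξ k j ω : ℝ) ≤ thr k}

lemma gwNo_meas {Ω : Type*} (ξ : ℕ → ℕ → Ω → ℕ) (Z : ℕ → Ω → ℕ)
    (hZ0 : ∀ ω, Z 0 ω = 1)
    (hZrec : ∀ n ω, Z (n + 1) ω = ∑ i ∈ Finset.range (Z n ω), ξ n i ω) (thr : ℕ → ℝ) (i : ℕ) :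
    MeasurableSet[gwF ξ i] (gwNo ξ Z thr i) := by
  have e : gwNo ξ Z thr i = ⋂ k, ⋂ (_ : k < i), ⋂ j, 
      ((Z k ⁻¹' {a | ¬ j < a}) ∪ (ξ k j ⁻¹' {a | (a:ℝ) ≤ thr k})) := by
    ext ω
    simp only [gwNo, Set.mem_ofPred_eq, Set.mem_iInter, Set.mem_union, Set.mem_preimage, imp_iff_not_or]
  rw [e]
  refine MeasurableSet.iInter fun k => MeasurableSet.iInter fun hk => MeasurableSet.iInter fun j => 
    MeasurableSet.union ?_ ?_
  · exact ((gwF_Z ξ Z hZ0 hZrec k).mono (gwF_mono ξ hk.le) le_rfl) (MeasurableSet.of_discrete)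
  · exact (gwF_xi ξ hk j) (MeasurableSet.of_discrete)

lemma gwNo_succ {Ω : Type*} [MeasurableSpace Ω] (μ : Measure Ω) [IsProbabilityMeasure μ]
    (ξ : ℕ → ℕ → Ω → ℕ)
    (hmeas : ∀ n i, Measurable (ξ n i))
    (hindep : iIndepFun
      (fun p : ℕ × ℕ => ξ p.1 p.2) μ)
    (hident : ∀ n i, Measure.map (ξ n i) μ = Measure.map (ξ 0 0) μ)
    (Z : ℕ → Ω → ℕ)
    (hZ0 : ∀ ω, Z 0 ω = 1)
    (hZrec : ∀ n ω, Z (n + 1) ω = ∑ i ∈ Finset.range (Z n ω), ξ n i ω)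
    (thr : ℕ → ℝ) (i : ℕ) :
    μ.real (gwNo ξ Z thr (i+1)) = 
      ∫ ω in gwNo ξ Z thr i, (1 - μ.real {ω | thr i < (ξ 0 0 ω : ℝ)}) ^ Z i ω ∂μ := by
  have hk := gw_key μ ξ hmeas hindep hident (Z i) i (gwF_Z ξ Z hZ0 hZrec i) _ 
    (gwNo_meas ξ Z hZ0 hZrec thr i) (fun k => if (k:ℝ) ≤ thr i then 1 else 0)
    (fun k => by split_ifs <;> norm_num) (fun k => by split_ifs <;> norm_num)
  have hXm : Measurable fun ω => (ξ 0 0 ω : ℝ) := measurable_from_top.comp (hmeas 0 0)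
  have hms : MeasurableSet {ω | thr i < (ξ 0 0 ω : ℝ)} := measurableSet_lt measurable_const hXm
  have e1 : ∫ ω, (if (ξ 0 0 ω : ℝ) ≤ thr i then (1:ℝ) else 0) ∂μ = 
      1 - μ.real {ω | thr i < (ξ 0 0 ω : ℝ)} := by
    rw [← probReal_compl_eq_one_sub hms, ← integral_indicator_one hms.compl]
    congr 1
    ext ω
    by_cases h : (ξ 0 0 ω : ℝ) ≤ thr i
    · rw [if_pos h, Set.indicator_of_mem]; rfl
      simpa using h
    · rw [if_neg h, Set.indicator_of_notMem]
      simpa using h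
  rw [e1] at hk
  rw [← hk]
  have hms1 : MeasurableSet (gwNo ξ Z thr (i+1)) := 
    gwF_le ξ hmeas _ _ (gwNo_meas ξ Z hZ0 hZrec thr (i+1))
  have hms0 : MeasurableSet (gwNo ξ Z thr i) := 
    gwF_le ξ hmeas _ _ (gwNo_meas ξ Z hZ0 hZrec thr i)
  rw [← integral_indicator_one hms1, ← integral_indicator hms0]
  congr 1
  ext ω
  by_cases h0 : ω ∈ gwNo ξ Z thr i
  · rw [Set.indicator_of_mem h0]
    by_cases h1 : ∀ j, j < Z i ω → (ξ i j ω : ℝ) ≤ thr i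
    · rw [Set.indicator_of_mem, Finset.prod_eq_one]; rfl
      · intro j hj
        rw [if_pos (h1 j (Finset.mem_range.1 hj))]
      · intro k hk
        rcases Nat.lt_succ_iff_lt_or_eq.1 hk with h | h
        · exact h0 k h
        · rw [h]; exact h1
    · rw [Set.indicator_of_notMem fun (h : ω ∈ gwNo ξ Z thr (i+1)) => h1 (h i i.lt_succ_self)]
      push Not at h1
      obtain ⟨j, hj, hj2⟩ := h1
      exact (Finset.prod_eq_zero (Finset.mem_range.2 hj) (if_neg (not_le.2 hj2))).symm
  · rw [Set.indicator_of_notMem h0, Set.indicator_of_notMem]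
    exact fun h => h0 fun k hk => h k (hk.trans i.lt_succ_self)

lemma gw_tail {Ω : Type*} [MeasurableSpace Ω] (μ : Measure Ω) [IsProbabilityMeasure μ]
    (ξ : ℕ → ℕ → Ω → ℕ)
    (hmeas : ∀ n i, Measurable (ξ n i))
    (hindep : iIndepFun
      (fun p : ℕ × ℕ => ξ p.1 p.2) μ)
    (hident : ∀ n i, Measure.map (ξ n i) μ = Measure.map (ξ 0 0) μ)
    (Z : ℕ → Ω → ℕ)
    (hZ0 : ∀ ω, Z 0 ω = 1)
    (hZrec : ∀ n ω, Z (n + 1) ω = ∑ i ∈ Finset.range (Z n ω), ξ n i ω)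
    (m : ℝ) (hm1 : 1 < m) (v δ : ℝ) (hv : 0 < v) (hδ1 : δ < 1)
    (k l : ℕ) (A : Set Ω) (hA : MeasurableSet[gwF ξ k] A)
    (hphi : (fun s : ℝ => ∫ ω, s ^ ξ 0 0 ω ∂μ)^[l] (Real.exp (-v / m ^ l)) ≤ 1 - (1 - δ) * v)
    (hphi0 : 0 ≤ (fun s : ℝ => ∫ ω, s ^ ξ 0 0 ω ∂μ)^[l] (Real.exp (-v / m ^ l)))
    (x ε : ℝ) (hx : 0 ≤ x) (hε : 0 < (1 - δ) * (1 + ε) - 1)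
    (hAZ : ∀ ω ∈ A, m ^ k * (1 + ε) * x ≤ (Z k ω : ℝ)) :
    μ.real (A ∩ {ω | ¬ x < (Z (k + l) ω : ℝ) / m ^ (k + l)}) ≤ 
      Real.exp (-(v * x * ((1 - δ) * (1 + ε) - 1))) * μ.real A := by
  have hm0 : 0 < m := by linarith
  have hAm := gwF_le ξ hmeas _ _ hA
  have hZm : ∀ n, Measurable (Z n) := fun n => (gwF_Z ξ Z hZ0 hZrec n).mono (gwF_le ξ hmeas n) le_rfl
  have hI : ∀ (n : ℕ) (s : ℝ), 0 ≤ s → s ≤ 1 → Integrable (fun ω => s ^ Z n ω) μ := fun n s hs0 hs1 =>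
      Integrable.mono' (integrable_const (1:ℝ)) 
        ((measurable_from_top (f := fun k : ℕ => s ^ k)).comp (hZm n)).aestronglyMeasurable
        (ae_of_all _ fun ω => by
          rw [Real.norm_of_nonneg (by positivity)]
          exact pow_le_one₀ hs0 hs1)
  set s := Real.exp (-v / m ^ l) with hs
  have hs0 : 0 ≤ s := (Real.exp_pos _).le
  have hs1 : s ≤ 1 := Real.exp_le_one_iff.2 (by
    rw [neg_div]; have := div_pos hv (pow_pos hm0 l); linarith)
  have it := gw_iter μ ξ hmeas hindep hident Z hZ0 hZrec k A hA l s hs0 hs1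
  set φ := (fun s : ℝ => ∫ ω, s ^ ξ 0 0 ω ∂μ)^[l] s with hφ
  have hφ1 : φ ≤ Real.exp (-((1 - δ) * v)) := by
    have := Real.add_one_le_exp (-((1 - δ) * v)); linarith
  have hφ2 : φ ≤ 1 := by nlinarith [mul_pos (sub_pos.2 hδ1) hv]
  have hGm : MeasurableSet {ω | ¬ x < (Z (k + l) ω : ℝ) / m ^ (k + l)} := by
    have : Measurable fun ω => (Z (k+l) ω : ℝ) / m ^ (k + l) := 
      (measurable_from_top (f := fun a : ℕ => (a:ℝ) / m ^ (k+l))).comp (hZm (k+l))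
    exact (measurableSet_lt measurable_const this).compl
  have b1 : μ.real (A ∩ {ω | ¬ x < (Z (k + l) ω : ℝ) / m ^ (k + l)}) ≤ 
      ∫ ω in A, Real.exp (v * x * m ^ k) * s ^ Z (k + l) ω ∂μ := by
    rw [Set.inter_comm, ← measureReal_restrict_apply hGm, ← integral_indicator_one hGm]
    refine integral_mono ((integrable_const (1:ℝ)).indicator hGm) ((hI _ s hs0 hs1).integrableOn.const_mul _) fun ω => ?_
    by_cases hω : ω ∈ {ω | ¬ x < (Z (k + l) ω : ℝ) / m ^ (k + l)}
    · rw [Set.indicator_of_mem hω]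
      simp only [Pi.one_apply]
      rw [hs, ← Real.exp_nat_mul, ← Real.exp_add]
      apply Real.one_le_exp
      have h1 : (Z (k + l) ω : ℝ) / m ^ (k + l) ≤ x := not_lt.1 hω
      have h2 : v * x * m ^ k + (Z (k + l) ω : ℝ) * (-v / m ^ l) = 
          v * m ^ k * (x - (Z (k + l) ω : ℝ) / m ^ (k + l)) := by
        rw [pow_add]; field_simp; ring
      rw [h2]
      exact mul_nonneg (by positivity) (by linarith)
    · rw [Set.indicator_of_notMem hω]; positivity
  refine b1.trans ?_
  rw [integral_const_mul, it]
  have b2 : ∫ ω in A, φ ^ Z k ω ∂μ ≤ ∫ ω in A, Real.exp (-((1 - δ) * v * (m ^ k * (1 + ε) * x))) ∂μ := by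
    refine setIntegral_mono_on (hI k φ hphi0 hφ2).integrableOn (integrable_const _).integrableOn hAm fun ω hω => ?_
    calc φ ^ Z k ω ≤ Real.exp (-((1 - δ) * v)) ^ Z k ω := pow_le_pow_left₀ hphi0 hφ1 _
      _ = Real.exp (-((1 - δ) * v * Z k ω)) := by rw [← Real.exp_nat_mul]; ring_nf
      _ ≤ _ := by
        apply Real.exp_le_exp.2
        have := mul_le_mul_of_nonneg_left (hAZ ω hω) (mul_pos (sub_pos.2 hδ1) hv).le
        linarith
  rw [setIntegral_const, smul_eq_mul] at b2
  calc _ ≤ Real.exp (v * x * m ^ k) * (μ.real A * Real.exp (-((1 - δ) * v * (m ^ k * (1 + ε) * x)))) := by gcongr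
    _ = Real.exp (v * x * m ^ k + -((1 - δ) * v * (m ^ k * (1 + ε) * x))) * μ.real A := by rw [Real.exp_add]; ring
    _ ≤ _ := by
      gcongr
      have h1 : 1 ≤ m ^ k := one_le_pow₀ hm1.le
      have h2 : 0 ≤ v * x * ((1 - δ) * (1 + ε) - 1) := by positivity
      nlinarith

/-- If `E(ξ log ξ) < ∞`, then for every `ε > 0`,
`ℙ(W_n > x) ≥ (1+o(1)) ∑_{i=0}^{n-1} m^i F̄(m^{i+1}(1+ε)x)` as `x → ∞`,
uniformly in `n ≥ 1`. -/
theorem gw_lower_bound_xlogx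
    {Ω : Type*} [MeasurableSpace Ω] (μ : Measure Ω) [IsProbabilityMeasure μ]
    (ξ : ℕ → ℕ → Ω → ℕ)
    (hmeas : ∀ n i, Measurable (ξ n i))
    (hindep : iIndepFun
      (fun p : ℕ × ℕ => ξ p.1 p.2) μ)
    (hident : ∀ n i, Measure.map (ξ n i) μ = Measure.map (ξ 0 0) μ)
    (hint : Integrable (fun ω => (ξ 0 0 ω : ℝ)) μ)
    (m : ℝ) (hm : m = ∫ ω, (ξ 0 0 ω : ℝ) ∂μ) (hm1 : 1 < m)
    (Z : ℕ → Ω → ℕ)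
    (hZ0 : ∀ ω, Z 0 ω = 1)
    (hZrec : ∀ n ω, Z (n + 1) ω = ∑ i ∈ Finset.range (Z n ω), ξ n i ω)
    (W : ℕ → Ω → ℝ) (hW : ∀ n ω, W n ω = (Z n ω : ℝ) / m ^ n)
    (Fbar : ℝ → ℝ) (hFbar : ∀ x, Fbar x = (μ {ω | x < (ξ 0 0 ω : ℝ)}).toReal)
    -- `E(ξ log ξ) < ∞`
    (hmomlog : Integrable (fun ω => (ξ 0 0 ω : ℝ) * Real.log (ξ 0 0 ω : ℝ)) μ) :
    ∀ ε > (0 : ℝ), ∀ ε' > (0 : ℝ), ∃ x₀ : ℝ, ∀ x ≥ x₀, ∀ n : ℕ, 1 ≤ n →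
      (1 - ε') * ∑ i ∈ Finset.range n, m ^ i * Fbar (m ^ (i + 1) * (1 + ε) * x) ≤
        (μ {ω | x < W n ω}).toReal := by
  intro ε hε ε' hε'
  have hm0 : 0 < m := by linarith
  obtain ⟨δ, hδ0, hδa, hδb, hδc⟩ : ∃ δ : ℝ, 0 < δ ∧ 3 * δ ≤ ε' ∧ δ < 1 / 2 ∧
      0 < (1 - δ) * (1 + ε) - 1 := by
    refine ⟨min (min (ε' / 3) (1/4)) (ε / (2 * (1 + ε))), by positivity, ?_, ?_, ?_⟩
    · have := (min_le_left (min (ε' / 3) (1/4)) (ε / (2 * (1 + ε)))).trans (min_le_left _ _)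
      linarith
    · have := (min_le_left (min (ε' / 3) (1/4)) (ε / (2 * (1 + ε)))).trans (min_le_right _ _)
      linarith
    · have := min_le_right (min (ε' / 3) (1/4)) (ε / (2 * (1 + ε)))
      rw [le_div_iff₀ (by positivity)] at this
      linarith
  obtain ⟨v, hv0, hv1, hphi⟩ := gw_phi μ (ξ 0 0) (hmeas 0 0) hint hmomlog m hm hm1 δ hδ0
  have hphi0 : ∀ l : ℕ, ∀ s : ℝ, 0 ≤ s → 0 ≤ (fun s : ℝ => ∫ ω, s ^ ξ 0 0 ω ∂μ)^[l] s := by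
    intro l
    induction l with
    | zero => intro s hs; simpa using hs
    | succ l ih =>
      intro s hs
      rw [Function.iterate_succ_apply]
      exact ih _ (integral_nonneg fun ω => pow_nonneg hs _)
  set c := (1 - δ) * (1 + ε) - 1 with hc
  have hm' : 0 < m - 1 := by linarith
  refine ⟨max (1 / (δ * v * c)) (m / ((m - 1) * (1 + ε) * (δ * v))), fun x hx n _ => ?_⟩
  have hxa : 1 / (δ * v * c) ≤ x := (le_max_left _ _).trans hx
  have hxb : m / ((m - 1) * (1 + ε) * (δ * v)) ≤ x := (le_max_right _ _).trans hx
  have hx0 : 0 < x := lt_of_lt_of_le (by positivity) hxa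
  have hexp : Real.exp (-(v * x * c)) ≤ δ := by
    rw [Real.exp_neg]
    have h1 := Real.add_one_le_exp (v * x * c)
    rw [div_le_iff₀ (by positivity)] at hxa
    have h2 : δ⁻¹ ≤ Real.exp (v * x * c) := by
      rw [inv_le_iff_one_le_mul₀ hδ0]
      nlinarith
    exact inv_le_of_inv_le₀ hδ0 h2
  set thr : ℕ → ℝ := fun i => m ^ (i + 1) * (1 + ε) * x with hthr
  set p : ℕ → ℝ := fun i => μ.real {ω | thr i < (ξ 0 0 ω : ℝ)} with hp
  have hFp : ∀ i, Fbar (m ^ (i + 1) * (1 + ε) * x) = p i := fun i => by rw [hFbar]; rfl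
  simp only [hFp]
  have hp0 : ∀ i, 0 ≤ p i := fun i => measureReal_nonneg
  have hp1 : ∀ i, p i ≤ 1 := fun i => measureReal_le_one
  set S := ∑ i ∈ Finset.range n, m ^ i * p i with hS
  have hS0 : 0 ≤ S := Finset.sum_nonneg fun i _ => mul_nonneg (by positivity) (hp0 i)
  have hSb : S ≤ δ * v := by
    have h1 := gw_S_bound μ (ξ 0 0) (hmeas 0 0) hint hm hm1 ((1 + ε) * x) (by positivity) n
    simp only [← mul_assoc] at h1
    refine le_trans (show S ≤ m / ((m - 1) * (1 + ε) * x) from h1) ?_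
    rw [div_le_iff₀ (by positivity)] at hxb ⊢
    linarith
  have hui : ∀ i < n, m ^ i * p i ≤ v := by
    intro i hi
    have : m ^ i * p i ≤ S := Finset.single_le_sum (f := fun i => m ^ i * p i)
      (fun j _ => mul_nonneg (by positivity) (hp0 j)) (Finset.mem_range.2 hi)
    nlinarith
  set C : ℕ → Set Ω := gwNo ξ Z thr with hC
  have hCF : ∀ i, MeasurableSet[gwF ξ i] (C i) := gwNo_meas ξ Z hZ0 hZrec thr
  have hCm : ∀ i, MeasurableSet (C i) := fun i => gwF_le ξ hmeas _ _ (hCF i)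
  have hCanti : ∀ {i j}, i ≤ j → C j ⊆ C i := fun {i j} hij ω h k hk => h k (hk.trans_le hij)
  have hC0 : C 0 = Set.univ := by
    ext ω; simp [hC, gwNo]
  have hZm : ∀ n, Measurable (Z n) := fun n => (gwF_Z ξ Z hZ0 hZrec n).mono (gwF_le ξ hmeas n) le_rfl
  -- the union has probability at least (1 - 2δ) S
  have hq : (1 - 2 * δ) * S ≤ μ.real (C n)ᶜ := by
    by_cases hcase : δ * v ≤ μ.real (C n)ᶜ
    · nlinarith
    · have hcase' := (not_le.1 hcase).le
      have ind : ∀ k ≤ n, (1 - 2 * δ) * ∑ i ∈ Finset.range k, m ^ i * p i ≤ μ.real (C k)ᶜ := by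
        intro k
        induction k with
        | zero => intro _; simp
        | succ k ih =>
          intro hk
          have h1 := ih (by omega)
          have hCk : μ.real (C k)ᶜ ≤ δ * v := (measureReal_mono 
            (Set.compl_subset_compl.2 (hCanti (by omega)))).trans hcase'
          have hphik : ∫ ω, Real.exp (-v / m ^ k) ^ Z k ω ∂μ ≤ 1 - (1 - δ) * v := by
            have := gw_iter μ ξ hmeas hindep hident Z hZ0 hZrec 0 Set.univ MeasurableSet.univ k
              (Real.exp (-v / m ^ k)) (Real.exp_pos _).le (Real.exp_le_one_iff.2 (by
                rw [neg_div]; have := div_pos hv0 (pow_pos hm0 k); linarith))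
            simp only [zero_add, hZ0, pow_one, Measure.restrict_univ, integral_const, probReal_univ,
              one_smul] at this
            rw [this]
            exact hphi k
          have h2 := gw_D μ (Z k) (hZm k) (C k) (hCm k) (m ^ k) v (p k) δ (by positivity) hv0
            (hp0 k) (hp1 k) (hui k (by omega)) hCk hphik
          have h3 := gwNo_succ μ ξ hmeas hindep hident Z hZ0 hZrec thr k
          rw [← h3] at h2
          rw [Finset.sum_range_succ, mul_add]
          rw [probReal_compl_eq_one_sub (hCm _)] at h1 ⊢
          linarith
      exact ind n le_rfl
  -- on the union, W n > x with large probability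
  set G : Set Ω := {ω | x < W n ω} with hG
  have hGm : MeasurableSet G := by
    have : Measurable (W n) := by
      have e : W n = fun ω => (Z n ω : ℝ) / m ^ n := funext (hW n)
      rw [e]
      exact (measurable_from_top (f := fun a : ℕ => (a:ℝ) / m ^ n)).comp (hZm n)
    exact measurableSet_lt measurable_const this
  have hfin : ∀ k ≤ n, (1 - δ) * μ.real (C k)ᶜ ≤ μ.real ((C k)ᶜ ∩ G) := by
    intro k
    induction k with
    | zero => intro _; simp [hC0]
    | succ k ih =>
      intro hk
      have h1 := ih (by omega)
      have hsub : C (k+1) ⊆ C k := hCanti (by omega)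
      have hDF : MeasurableSet[gwF ξ (k+1)] (C k \ C (k+1)) := 
        MeasurableSet.diff (gwF_mono ξ k.le_succ _ (hCF k)) (hCF (k+1))
      have hDm := gwF_le ξ hmeas _ _ hDF
      have hu : (C (k+1))ᶜ = (C k)ᶜ ∪ (C k \ C (k+1)) := by
        ext ω
        have := @hsub ω
        simp only [Set.mem_compl_iff, Set.mem_union, Set.mem_sdiff]
        tauto
      have hdis : Disjoint (C k)ᶜ (C k \ C (k+1)) := by
        rw [Set.disjoint_left]
        intro ω h h'
        exact h h'.1
      have h2 : μ.real ((C k \ C (k+1)) ∩ Gᶜ) ≤ δ * μ.real (C k \ C (k+1)) := by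
        have ht := gw_tail μ ξ hmeas hindep hident Z hZ0 hZrec m hm1 v δ hv0 (by linarith) (k+1) (n - (k+1))
          (C k \ C (k+1)) hDF (hphi _) (hphi0 _ _ (Real.exp_pos _).le) x ε hx0.le hδc ?_
        · rw [Nat.add_sub_cancel' hk] at ht
          have e : Gᶜ = {ω | ¬ x < (Z n ω : ℝ) / m ^ n} := by
            ext ω; simp [hG, hW]
          rw [e]
          exact ht.trans (mul_le_mul_of_nonneg_right hexp measureReal_nonneg)
        · rintro ω ⟨ha, hb⟩
          have : ∃ j, j < Z k ω ∧ thr k < (ξ k j ω : ℝ) := by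
            by_contra! hcon
            refine hb fun i hi => ?_
            rcases Nat.lt_succ_iff_lt_or_eq.1 hi with h | h
            · exact ha i h
            · rw [h]; exact hcon
          obtain ⟨j, hj, hj2⟩ := this
          have h5 : ξ k j ω ≤ Z (k+1) ω := by
            rw [hZrec]
            exact Finset.single_le_sum (f := fun j => ξ k j ω) (fun _ _ => Nat.zero_le _) (Finset.mem_range.2 hj)
          have h6 : (ξ k j ω : ℝ) ≤ Z (k+1) ω := by exact_mod_cast h5
          exact hj2.le.trans h6
      have h3 : μ.real ((C k \ C (k+1)) ∩ G) + μ.real ((C k \ C (k+1)) ∩ Gᶜ) = μ.real (C k \ C (k+1)) := by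
        have := measureReal_inter_add_sdiff (μ := μ) (s := C k \ C (k+1)) hGm
        exact this
      rw [hu, Set.union_inter_distrib_right, measureReal_union hdis hDm, 
        measureReal_union (hdis.mono Set.inter_subset_left Set.inter_subset_left) (hDm.inter hGm)]
      linarith
  have hlast : μ.real ((C n)ᶜ ∩ G) ≤ μ.real G := measureReal_mono Set.inter_subset_right
  have h4 := hfin n le_rfl
  have h5 : (1 - δ) * ((1 - 2 * δ) * S) ≤ (1 - δ) * μ.real (C n)ᶜ := 
    mul_le_mul_of_nonneg_left hq (by linarith)
  have h6 : (1 - ε') * S ≤ (1 - δ) * ((1 - 2 * δ) * S) := by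
    rw [← mul_assoc]
    exact mul_le_mul_of_nonneg_right (by nlinarith) hS0
  exact h6.trans (h5.trans (h4.trans hlast))
end
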